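/- arXiv:1310.6813 — 2 statements merged into one kernel-verified Lean document; each statement's English description precedes it below -/
import Mathlib

section
/- Let φ : Pauli(n) → Pauli(n) be a group automorphism of the Pauli group that fixes all scalars (i.e., φ(λ·I) = λ·I for all λ ∈ {1,−1,i,−i}). Then there exists a Clifford operator C ∈ Clifford(n) such that C P C⁻¹ = φ(P) for all P ∈ Pauli(n). -/
open scoped Matrix Kronecker

noncomputable section

def PX : Matrix (Fin 2) (Fin 2) ℂ := !![0, 1; 1, 0]
def PY : Matrix (Fin 2) (Fin 2) ℂ := !![0, -Complex.I; Complex.I, 0]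
def PZ : Matrix (Fin 2) (Fin 2) ℂ := !![1, 0; 0, -1]
def gH : Matrix (Fin 2) (Fin 2) ℂ := (Real.sqrt 2 : ℂ)⁻¹ • !![1, 1; 1, -1]
def gS : Matrix (Fin 2) (Fin 2) ℂ := !![1, 0; 0, Complex.I]
def gCZ : Matrix (Fin 4) (Fin 4) ℂ :=
  !![1,0,0,0; 0,1,0,0; 0,0,1,0; 0,0,0,-1]
def ω : ℂ := Complex.exp (Complex.I * Real.pi / 4)

/-- Kronecker product of square matrices, with index types flattened to `Fin (m * k)`. -/
def kron' {m k : ℕ} (A : Matrix (Fin m) (Fin m) ℂ) (B : Matrix (Fin k) (Fin k) ℂ) :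
    Matrix (Fin (m * k)) (Fin (m * k)) ℂ :=
  Matrix.reindex finProdFinEquiv finProdFinEquiv (A ⊗ₖ B)

/-- `n`-fold tensor product `P 0 ⊗ P 1 ⊗ ⋯ ⊗ P (n-1)` of 2×2 matrices. -/
def tensorPow : (n : ℕ) → (Fin n → Matrix (Fin 2) (Fin 2) ℂ) →
    Matrix (Fin (2 ^ n)) (Fin (2 ^ n)) ℂ
  | 0, _ => 1
  | n + 1, P =>
      Matrix.reindex (finCongr (pow_succ' 2 n).symm) (finCongr (pow_succ' 2 n).symm)
        (kron' (P 0) (tensorPow n fun i => P i.succ))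

/-- The set of n-qubit Pauli operators: λ • P₁ ⊗ ⋯ ⊗ Pₙ with λ ∈ {1,-1,i,-i},
    Pⱼ ∈ {I, X, Y, Z}. -/
def PauliSet (n : ℕ) : Set (Matrix (Fin (2 ^ n)) (Fin (2 ^ n)) ℂ) :=
  {M | ∃ (lam : ℂ) (P : Fin n → Matrix (Fin 2) (Fin 2) ℂ),
    lam ∈ ({1, -1, Complex.I, -Complex.I} : Set ℂ) ∧
    (∀ i, P i ∈ ({1, PX, PY, PZ} : Set (Matrix (Fin 2) (Fin 2) ℂ))) ∧
    M = lam • tensorPow n P}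

/-- `I_{2^a} ⊗ G ⊗ I_{2^b}`, where `G` acts on `c` qubits and `a + c + b = n`. -/
def embed (a c b n : ℕ) (h : a + c + b = n)
    (G : Matrix (Fin (2 ^ c)) (Fin (2 ^ c)) ℂ) :
    Matrix (Fin (2 ^ n)) (Fin (2 ^ n)) ℂ :=
  Matrix.reindex (finCongr (by subst h; rw [pow_add, pow_add, mul_assoc]))
    (finCongr (by subst h; rw [pow_add, pow_add, mul_assoc]))
    (kron' (1 : Matrix (Fin (2 ^ a)) (Fin (2 ^ a)) ℂ)
      (kron' G (1 : Matrix (Fin (2 ^ b)) (Fin (2 ^ b)) ℂ)))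

/-- Generators of the Clifford group: ω•I, and H, S, CZ applied to (adjacent) qubits. -/
def CliffordGenSet (n : ℕ) : Set (Matrix (Fin (2 ^ n)) (Fin (2 ^ n)) ℂ) :=
  {ω • 1} ∪
  {M | ∃ a b, ∃ h : a + 1 + b = n, M = embed a 1 b n h gH ∨ M = embed a 1 b n h gS} ∪
  {M | ∃ a b, ∃ h : a + 2 + b = n, M = embed a 2 b n h gCZ}

/-- The Clifford group on n qubits, as a subgroup of `GL (2^n) ℂ`. -/
def CliffordGroup (n : ℕ) : Subgroup (GL (Fin (2 ^ n)) ℂ) :=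
  Subgroup.closure
    {u : GL (Fin (2 ^ n)) ℂ | (u : Matrix (Fin (2 ^ n)) (Fin (2 ^ n)) ℂ) ∈ CliffordGenSet n}

/-- The Pauli group on n qubits, as a subgroup of `GL (2^n) ℂ`.
    (Its underlying set of matrices is exactly `PauliSet n`.) -/
def PauliGroup (n : ℕ) : Subgroup (GL (Fin (2 ^ n)) ℂ) :=
  Subgroup.closure
    {u : GL (Fin (2 ^ n)) ℂ | (u : Matrix (Fin (2 ^ n)) (Fin (2 ^ n)) ℂ) ∈ PauliSet n}

/-- Z on the first qubit, identity elsewhere. -/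
def ZFirst (n : ℕ) : Matrix (Fin (2 ^ n)) (Fin (2 ^ n)) ℂ :=
  tensorPow n fun i => if i.val = 0 then PZ else 1

/-- Z on the last qubit, identity elsewhere. -/
def ZLast (n : ℕ) : Matrix (Fin (2 ^ n)) (Fin (2 ^ n)) ℂ :=
  tensorPow n fun i => if i.val = n - 1 then PZ else 1

/-- X on the last qubit, identity elsewhere. -/
def XLast (n : ℕ) : Matrix (Fin (2 ^ n)) (Fin (2 ^ n)) ℂ :=
  tensorPow n fun i => if i.val = n - 1 then PX else 1

section PauliSystem

variable {A : Type*} [Ring A]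

/-- Two units anticommute. -/
def AntiCommute (a b : Aˣ) : Prop := a * b = -(b * a)

namespace AntiCommute

variable {a b c : Aˣ}

theorem symm (h : AntiCommute a b) : AntiCommute b a := by
  unfold AntiCommute at *; rw [h, neg_neg]

theorem mul_right (h : AntiCommute a b) (h' : Commute a c) : AntiCommute a (b * c) := by
  unfold AntiCommute at *
  rw [← mul_assoc, h, neg_mul, mul_assoc, h'.eq, mul_assoc]

theorem mul_right' (h : Commute a b) (h' : AntiCommute a c) : AntiCommute a (b * c) := by
  unfold AntiCommute at *
  rw [← mul_assoc, h.eq, mul_assoc, h', mul_neg, mul_assoc]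

theorem mul_left (h : AntiCommute a c) (h' : Commute b c) : AntiCommute (a * b) c :=
  (h.symm.mul_right h'.symm).symm

theorem mul_left' (h : Commute a c) (h' : AntiCommute b c) : AntiCommute (a * b) c :=
  (mul_right' h.symm h'.symm).symm

theorem commute_mul (h : AntiCommute a b) (h' : AntiCommute a c) : Commute a (b * c) := by
  unfold AntiCommute at *
  change a * (b * c) = b * c * a
  rw [← mul_assoc, h, neg_mul, mul_assoc, h', mul_neg, neg_neg, mul_assoc]

theorem not_commute [Algebra ℂ A] [Nontrivial A] (h : AntiCommute a b) : ¬ Commute a b := by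
  intro h'
  unfold AntiCommute at h
  rw [← h'.eq] at h
  have h2 : ((a * b : Aˣ) : A) + (a * b : Aˣ) = 0 := by
    nth_rewrite 1 [h]
    rw [Units.val_neg, neg_add_cancel]
  have h3 : (2 : ℂ) • ((a * b : Aˣ) : A) = 0 := by rw [two_smul, h2]
  exact (a * b).ne_zero ((smul_eq_zero_iff_right two_ne_zero).1 h3)

end AntiCommute

variable [Algebra ℂ A]

variable (A) in
/-- The imaginary unit as a unit of a complex algebra. -/
def imUnit : Aˣ :=
  Units.map (algebraMap ℂ A).toMonoidHom (Units.mk0 Complex.I Complex.I_ne_zero)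

theorem val_imUnit : (imUnit A : A) = algebraMap ℂ A Complex.I := rfl

theorem imUnit_commute (a : Aˣ) : Commute (imUnit A) a := by
  refine Units.ext ?_
  simpa [val_imUnit] using Algebra.commutes Complex.I (a : A)

theorem imUnit_mul_self : imUnit A * imUnit A = -1 := by
  refine Units.ext ?_
  simp [val_imUnit, ← map_mul]

theorem imUnit_mul_imUnit_mul (a : Aˣ) : imUnit A * (imUnit A * a) = -a := by
  rw [← mul_assoc, imUnit_mul_self, neg_one_mul]

theorem mul_imUnit (a : Aˣ) : a * imUnit A = imUnit A * a := (imUnit_commute a).symm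

theorem mul_imUnit_mul (a b : Aˣ) : a * (imUnit A * b) = imUnit A * (a * b) := by
  rw [← mul_assoc, mul_imUnit, mul_assoc]

theorem AntiCommute.sq_mul {a b : Aˣ} (h : AntiCommute a b) (ha : a * a = 1) (hb : b * b = 1) :
    imUnit A * (a * b) * (imUnit A * (a * b)) = 1 := by
  have h1 : a * b * (a * b) = -1 := by
    nth_rewrite 1 [h]
    rw [neg_mul, mul_assoc, ← mul_assoc a, ha, one_mul, hb]
  rw [mul_assoc, mul_imUnit_mul, imUnit_mul_imUnit_mul, h1, neg_neg]

/-- `(1 + i a) / √2`, which is `exp (i π a / 4)` when `a * a = 1`. -/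
def quarterExp (a : Aˣ) : A := ((Real.sqrt 2 : ℂ)⁻¹) • (1 + Complex.I • (a : A))

theorem inv_sqrt_two_mul_self : (Real.sqrt 2 : ℂ)⁻¹ * (Real.sqrt 2 : ℂ)⁻¹ = 2⁻¹ := by
  rw [← mul_inv, ← Complex.ofReal_mul, Real.mul_self_sqrt (by norm_num)]
  norm_num

theorem quarterExp_mul_neg {a : Aˣ} (ha : a * a = 1) :
    quarterExp a * quarterExp (-a) = 1 := by
  have ha' : (a : A) * a = 1 := by rw [← Units.val_mul, ha, Units.val_one]
  simp only [quarterExp, smul_mul_smul_comm, inv_sqrt_two_mul_self, Units.val_neg]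
  rw [mul_add, add_mul, add_mul]
  simp only [mul_one, one_mul, smul_mul_smul_comm, mul_neg, ha', Complex.I_mul_I, smul_neg,
    neg_smul, one_smul, neg_neg]
  rw [show (1 : A) + Complex.I • (a : A) + (-(Complex.I • (a : A)) + 1) = (2 : ℂ) • (1 : A) by
    rw [two_smul]; abel, smul_smul]
  norm_num

/-- `a` is an involution whose `quarterExp` belongs to the subgroup `K`. -/
def HasExp (K : Subgroup Aˣ) (a : Aˣ) : Prop :=
  a * a = 1 ∧ ∃ t ∈ K, (t : A) = quarterExp a

namespace HasExp

variable {K : Subgroup Aˣ} {a b : Aˣ}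

theorem val_inv_eq {t : Aˣ} (ha : a * a = 1) (ht : (t : A) = quarterExp a) :
    ((t⁻¹ : Aˣ) : A) = quarterExp (-a) := by
  rw [← mul_one ((t⁻¹ : Aˣ) : A), ← quarterExp_mul_neg ha, ← ht, ← mul_assoc, Units.inv_mul,
    one_mul]

theorem neg (h : HasExp K a) : HasExp K (-a) := by
  obtain ⟨ha, t, htK, ht⟩ := h
  exact ⟨by rw [neg_mul_neg, ha], t⁻¹, K.inv_mem htK, val_inv_eq ha ht⟩

theorem of_neg (h : HasExp K (-a)) : HasExp K a := by simpa using h.neg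

theorem conj (h : HasExp K a) {c : Aˣ} (hc : c ∈ K) : HasExp K (c * a * c⁻¹) := by
  obtain ⟨ha, t, htK, ht⟩ := h
  refine ⟨by rw [conj_mul, ha, mul_one, mul_inv_cancel], c * t * c⁻¹,
    K.mul_mem (K.mul_mem hc htK) (K.inv_mem hc), ?_⟩
  simp [ht, quarterExp, mul_add, add_mul]

theorem quarterExp_commute {t : Aˣ} (ht : (t : A) = quarterExp a) (h : Commute a b) :
    Commute t b := by
  have h' : (a : A) * b = b * a := by simpa using congrArg Units.val h.eq
  refine Units.ext ?_
  simp [ht, quarterExp, mul_add, add_mul, h']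

theorem quarterExp_conj {t : Aˣ} (ha : a * a = 1) (ht : (t : A) = quarterExp a)
    (h : AntiCommute a b) : t * b * t⁻¹ = imUnit A * (a * b) := by
  rw [mul_inv_eq_iff_eq_mul]
  have ha' : (a : A) * a = 1 := by rw [← Units.val_mul, ha, Units.val_one]
  have h' : (a : A) * b = -(b * a) := by simpa using congrArg Units.val h
  refine Units.ext ?_
  have h2 : (a : A) * b * a = - b := by rw [h', neg_mul, mul_assoc, ha', mul_one]
  simp only [Units.val_mul, ht, quarterExp, val_imUnit, smul_mul_assoc, mul_smul_comm, mul_add,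
    add_mul, one_mul, mul_one, ← Algebra.smul_def, h2, smul_neg, smul_smul, Complex.I_mul_I]
  simp [add_comm]

theorem mul (ha : HasExp K a) (hb : HasExp K b) (h : AntiCommute a b) :
    HasExp K (imUnit A * (a * b)) := by
  obtain ⟨ha, t, htK, ht⟩ := ha
  rw [← quarterExp_conj ha ht h]
  exact hb.conj htK

end HasExp

/-- Units satisfying the relations of the Pauli matrices `X, Y, Z` on `n` qubits. -/
structure IsPauliSystem {n : ℕ} (σ : Fin n → Fin 3 → Aˣ) : Prop where
  sq : ∀ j c, σ j c * σ j c = 1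
  cyc : ∀ j c, σ j c * σ j (c + 1) = imUnit A * σ j (c + 2)
  comm : ∀ j l c d, j ≠ l → Commute (σ j c) (σ l d)

/-- The subgroup generated by `i` and the Pauli matrices on the first `k` qubits. -/
def pauliSubgroup {n : ℕ} (σ : Fin n → Fin 3 → Aˣ) (k : ℕ) : Subgroup Aˣ :=
  Subgroup.closure ({imUnit A} ∪ {u | ∃ j : Fin n, ∃ c, (j : ℕ) < k ∧ u = σ j c})

namespace IsPauliSystem

variable {n : ℕ} {σ τ : Fin n → Fin 3 → Aˣ}

theorem conj (hσ : IsPauliSystem σ) (t : Aˣ) : IsPauliSystem fun j c => t * σ j c * t⁻¹ where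
  sq j c := by rw [conj_mul, hσ.sq, mul_one, mul_inv_cancel]
  cyc j c := by rw [conj_mul, hσ.cyc, mul_imUnit_mul, mul_assoc]
  comm j l c d h := by
    change _ * _ = _ * _
    rw [conj_mul, (hσ.comm j l c d h).eq, conj_mul]

theorem anti_succ (hσ : IsPauliSystem σ) (j : Fin n) (c : Fin 3) :
    AntiCommute (σ j c) (σ j (c + 1)) := by
  have inv : ∀ d, (σ j d)⁻¹ = σ j d := fun d => inv_eq_of_mul_eq_one_left (hσ.sq j d)
  have h : (σ j c * σ j (c + 1))⁻¹ = -(σ j c * σ j (c + 1)) := by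
    rw [hσ.cyc, mul_inv_rev, inv, mul_inv_eq_iff_eq_mul, neg_mul, mul_assoc, mul_imUnit,
      imUnit_mul_imUnit_mul, neg_neg]
  rw [mul_inv_rev, inv, inv] at h
  exact (neg_eq_iff_eq_neg.1 h.symm)

theorem anti (hσ : IsPauliSystem σ) (j : Fin n) {c d : Fin 3} (h : c ≠ d) :
    AntiCommute (σ j c) (σ j d) := by
  have : d = c + 1 ∨ c = d + 1 := by revert c d; decide
  obtain rfl | rfl := this
  · exact hσ.anti_succ j c
  · exact (hσ.anti_succ j d).symm

theorem mul_anti_cyc (hσ : IsPauliSystem σ) (j : Fin n) (c : Fin 3) :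
    σ j (c + 1) * σ j c = -(imUnit A * σ j (c + 2)) := by
  rw [(hσ.anti_succ j c).symm, hσ.cyc]

theorem imUnit_mem (k : ℕ) : imUnit A ∈ pauliSubgroup σ k :=
  Subgroup.subset_closure (Or.inl rfl)

theorem neg_mem {k : ℕ} {a : Aˣ} (ha : a ∈ pauliSubgroup σ k) : -a ∈ pauliSubgroup σ k := by
  rw [← imUnit_mul_imUnit_mul]
  exact mul_mem (imUnit_mem k) (mul_mem (imUnit_mem k) ha)

theorem mem {k : ℕ} {j : Fin n} (c : Fin 3) (h : (j : ℕ) < k) : σ j c ∈ pauliSubgroup σ k :=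
  Subgroup.subset_closure (Or.inr ⟨j, c, h, rfl⟩)

theorem commute_of_forall {k : ℕ} {a b : Aˣ} (hb : b ∈ pauliSubgroup σ k)
    (h : ∀ j : Fin n, ∀ c, (j : ℕ) < k → Commute a (σ j c)) : Commute a b := by
  induction hb using Subgroup.closure_induction with
  | mem x hx =>
    obtain rfl | ⟨j, c, hj, rfl⟩ := hx
    · exact (imUnit_commute a).symm
    · exact h j c hj
  | one => exact Commute.one_right a
  | mul x y _ _ hx hy => exact hx.mul_right hy
  | inv x _ hx => exact hx.inv_right

theorem commute_or_anti_of_forall {k : ℕ} {a b : Aˣ} (hb : b ∈ pauliSubgroup σ k)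
    (h : ∀ j : Fin n, ∀ c, (j : ℕ) < k → Commute a (σ j c) ∨ AntiCommute a (σ j c)) :
    Commute a b ∨ AntiCommute a b := by
  induction hb using Subgroup.closure_induction with
  | mem x hx =>
    obtain rfl | ⟨j, c, hj, rfl⟩ := hx
    · exact Or.inl (imUnit_commute a).symm
    · exact h j c hj
  | one => exact Or.inl (Commute.one_right a)
  | mul x y _ _ hx hy =>
    obtain hx | hx := hx <;> obtain hy | hy := hy
    · exact Or.inl (hx.mul_right hy)
    · exact Or.inr (.mul_right' hx hy)
    · exact Or.inr (hx.mul_right hy)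
    · exact Or.inl (hx.commute_mul hy)
  | inv x _ hx =>
    refine hx.imp (fun h => h.inv_right) fun h => ?_
    unfold AntiCommute at *
    rw [mul_inv_eq_iff_eq_mul, neg_mul, mul_assoc, h, mul_neg, neg_neg, inv_mul_cancel_left]

theorem commute_or_anti_gen (hσ : IsPauliSystem σ) (j l : Fin n) (c d : Fin 3) :
    Commute (σ j c) (σ l d) ∨ AntiCommute (σ j c) (σ l d) := by
  by_cases hjl : j = l
  · subst hjl
    by_cases hcd : c = d
    · subst hcd; exact Or.inl (Commute.refl _)
    · exact Or.inr (hσ.anti j hcd)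
  · exact Or.inl (hσ.comm j l c d hjl)

theorem commute_or_anti (hσ : IsPauliSystem σ) {k l : ℕ} {a b : Aˣ}
    (ha : a ∈ pauliSubgroup σ k) (hb : b ∈ pauliSubgroup σ l) :
    Commute a b ∨ AntiCommute a b :=
  commute_or_anti_of_forall hb fun j c _ =>
    (commute_or_anti_of_forall ha fun l d _ => hσ.commute_or_anti_gen j l c d).imp
      Commute.symm AntiCommute.symm

theorem mem_zero {a : Aˣ} (ha : a ∈ pauliSubgroup σ 0) :
    a = 1 ∨ a = -1 ∨ a = imUnit A ∨ a = -imUnit A := by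
  induction ha using Subgroup.closure_induction with
  | mem x hx =>
    obtain rfl | ⟨j, c, hj, rfl⟩ := hx
    · simp
    · omega
  | one => simp
  | mul x y _ _ hx hy =>
    obtain rfl | rfl | rfl | rfl := hx <;> obtain rfl | rfl | rfl | rfl := hy <;>
      simp [imUnit_mul_self]
  | inv x _ hx =>
    have h : (imUnit A)⁻¹ = -imUnit A :=
      inv_eq_of_mul_eq_one_left (by rw [neg_mul, imUnit_mul_self, neg_neg])
    obtain rfl | rfl | rfl | rfl := hx
    · simp
    · simp [inv_neg]
    · simp [h]
    · simp [h, inv_neg]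

theorem commute_of_le (hσ : IsPauliSystem σ) {k : ℕ} {a : Aˣ} (ha : a ∈ pauliSubgroup σ k)
    {j : Fin n} (c : Fin 3) (hj : k ≤ j) : Commute a (σ j c) :=
  (commute_of_forall ha fun l d hl => hσ.comm j l c d (by rintro rfl; omega)).symm

theorem mem_succ (hσ : IsPauliSystem σ) (k : Fin n) {a : Aˣ}
    (ha : a ∈ pauliSubgroup σ ((k : ℕ) + 1)) :
    ∃ b ∈ pauliSubgroup σ k, a = b ∨ ∃ c, a = b * σ k c := by
  have key : ∀ c d, ∃ e ∈ pauliSubgroup σ k, σ k c * σ k d = e ∨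
      ∃ c', σ k c * σ k d = e * σ k c' := by
    intro c d
    have : d = c ∨ d = c + 1 ∨ c = d + 1 := by revert c d; decide
    obtain rfl | rfl | rfl := this
    · exact ⟨1, one_mem _, Or.inl (hσ.sq _ _)⟩
    · exact ⟨imUnit A, imUnit_mem _, Or.inr ⟨c + 2, hσ.cyc _ _⟩⟩
    · exact ⟨-imUnit A, neg_mem (imUnit_mem _), Or.inr ⟨d + 2, by
        rw [hσ.mul_anti_cyc, neg_mul]⟩⟩
  induction ha using Subgroup.closure_induction with
  | mem x hx =>
    obtain rfl | ⟨j, c, hj, rfl⟩ := hx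
    · exact ⟨_, imUnit_mem _, Or.inl rfl⟩
    · obtain hj | hj := (Nat.lt_succ_iff_lt_or_eq.1 hj)
      · exact ⟨_, mem c hj, Or.inl rfl⟩
      · obtain rfl := Fin.ext hj
        exact ⟨1, one_mem _, Or.inr ⟨c, (one_mul _).symm⟩⟩
  | one => exact ⟨1, one_mem _, Or.inl rfl⟩
  | mul x y _ _ hx hy =>
    obtain ⟨b, hb, rfl | ⟨c, rfl⟩⟩ := hx <;> obtain ⟨b', hb', rfl | ⟨d, rfl⟩⟩ := hy
    · exact ⟨_, mul_mem hb hb', Or.inl rfl⟩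
    · exact ⟨_, mul_mem hb hb', Or.inr ⟨d, (mul_assoc _ _ _).symm⟩⟩
    · exact ⟨_, mul_mem hb hb', Or.inr ⟨c, by
        rw [mul_assoc, mul_assoc, (hσ.commute_of_le hb' c le_rfl).eq]⟩⟩
    · have h : b * σ k c * (b' * σ k d) = b * b' * (σ k c * σ k d) := by
        rw [mul_assoc, ← mul_assoc _ b', ← (hσ.commute_of_le hb' c le_rfl).eq]
        simp only [mul_assoc]
      rw [h]
      obtain ⟨e, he, h | ⟨c', h⟩⟩ := key c d
      · exact ⟨_, mul_mem (mul_mem hb hb') he, Or.inl (by rw [h])⟩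
      · exact ⟨_, mul_mem (mul_mem hb hb') he, Or.inr ⟨c', by rw [h, ← mul_assoc]⟩⟩
  | inv x _ hx =>
    obtain ⟨b, hb, rfl | ⟨c, rfl⟩⟩ := hx
    · exact ⟨_, inv_mem hb, Or.inl rfl⟩
    · refine ⟨_, inv_mem hb, Or.inr ⟨c, ?_⟩⟩
      rw [(hσ.commute_of_le hb c le_rfl).eq, mul_inv_rev,
        inv_eq_of_mul_eq_one_left (hσ.sq k c)]

theorem eq_one_or_neg_one_of_mem_zero [Nontrivial A] {a : Aˣ} (ha : a ∈ pauliSubgroup σ 0)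
    (h : a * a = 1) : a = 1 ∨ a = -1 := by
  have hne : (-1 : Aˣ) ≠ 1 := by
    intro h'
    refine AntiCommute.not_commute (a := (1 : Aˣ)) (b := 1) ?_ (Commute.refl _)
    simp [AntiCommute, h']
  obtain rfl | rfl | rfl | rfl := mem_zero ha
  · exact Or.inl rfl
  · exact Or.inr rfl
  · exact absurd (imUnit_mul_self.symm.trans h) hne
  · rw [neg_mul_neg] at h
    exact absurd (imUnit_mul_self.symm.trans h) hne

theorem hasExp_of_mul {K : Subgroup Aˣ} {a b c : Aˣ} (ha : HasExp K a) (hb : HasExp K b)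
    (h : AntiCommute a b) (hc : a * b = imUnit A * c) : HasExp K c := by
  have := ha.mul hb h
  rw [hc, imUnit_mul_imUnit_mul] at this
  exact this.of_neg

theorem hasExp_of_mul_neg {K : Subgroup Aˣ} {a b c : Aˣ} (ha : HasExp K a) (hb : HasExp K b)
    (h : AntiCommute a b) (hc : a * b = -(imUnit A * c)) : HasExp K c := by
  have := ha.mul hb h
  rwa [hc, mul_neg, imUnit_mul_imUnit_mul, neg_neg] at this

theorem hasExp_third (hσ : IsPauliSystem σ) {K : Subgroup Aˣ} {b : Aˣ} (j : Fin n)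
    {c d : Fin 3} (hb : ∀ c, Commute b (σ j c)) (hK : ∀ c, HasExp K (σ j c))
    (h : HasExp K (b * σ j c)) : HasExp K (b * σ j d) := by
  have anti : ∀ c d, c ≠ d → AntiCommute (σ j c) (b * σ j d) := fun c d hcd =>
    .mul_right' (hb c).symm (hσ.anti j hcd)
  have : d = c ∨ d = c + 1 ∨ d = c + 2 := by clear * -; decide +revert
  obtain rfl | rfl | rfl := this
  · exact h
  · refine hasExp_of_mul (hK (c + 2)) h (anti _ _ (by clear * -; decide +revert)) ?_
    have := hσ.cyc j (c + 2)
    rw [show c + 2 + 1 = c by clear * -; decide +revert, show c + 2 + 2 = c + 1 by clear * -; decide +revert] at this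
    rw [← mul_assoc, ← (hb _).eq, mul_assoc, this, mul_imUnit_mul]
  · refine hasExp_of_mul_neg (hK (c + 1)) h (anti _ _ (by clear * -; decide +revert)) ?_
    rw [← mul_assoc, ← (hb _).eq, mul_assoc, hσ.mul_anti_cyc, mul_neg, mul_imUnit_mul]

/-- Involutions of the group generated by a Pauli system have their `quarterExp` in `K` as soon as
the generators and the products `X_j Z_{j+1}` do. -/
theorem hasExp_of_mem [Nontrivial A] (hσ : IsPauliSystem σ) {K : Subgroup Aˣ}
    (hone : HasExp K 1) (hK : ∀ j c, HasExp K (σ j c))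
    (hadj : ∀ j l : Fin n, (l : ℕ) = j + 1 → HasExp K (σ j 0 * σ l 2)) (k : ℕ) (hk : k ≤ n) :
    ∀ a ∈ pauliSubgroup σ k, a * a = 1 → HasExp K a := by
  have hadj' : ∀ j l : Fin n, (l : ℕ) = j + 1 → ∀ c d, HasExp K (σ j c * σ l d) := by
    intro j l hjl c d
    have hne : j ≠ l := by rintro rfl; omega
    have h1 := hσ.hasExp_third (d := d) l (fun c => hσ.comm j l 0 c hne) (hK l) (hadj j l hjl)
    rw [(hσ.comm j l _ _ hne).eq] at h1 ⊢
    exact hσ.hasExp_third j (fun c => (hσ.comm j l c _ hne).symm) (hK j) h1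
  induction k with
  | zero =>
    intro a ha h
    obtain rfl | rfl := eq_one_or_neg_one_of_mem_zero ha h
    · exact hone
    · exact hone.neg
  | succ k ih =>
    intro a ha h
    have ih := ih (by omega)
    set l : Fin n := ⟨k, hk⟩ with hl
    obtain ⟨b, hb, hab⟩ := hσ.mem_succ l ha
    change b ∈ pauliSubgroup σ k at hb
    have hbl : ∀ c, Commute b (σ l c) := fun c => hσ.commute_of_le hb c le_rfl
    obtain rfl | ⟨c, rfl⟩ := hab
    · exact ih _ hb h
    have hb2 : b * b = 1 := by
      rwa [mul_assoc, ← mul_assoc _ b, ← (hbl c).eq, mul_assoc b, hσ.sq, mul_one] at h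
    obtain rfl | hk0 := Nat.eq_zero_or_pos k
    · obtain rfl | rfl := eq_one_or_neg_one_of_mem_zero hb hb2
      · simpa using hK l c
      · simpa using (hK l c).neg
    set j : Fin n := ⟨k - 1, by omega⟩ with hj
    have hjl : (l : ℕ) = j + 1 := by simp only [hl, hj]; omega
    have hne : j ≠ l := by rintro h; have := congrArg Fin.val h; omega
    have hjk : (j : ℕ) < k := by simp only [hj]; omega
    have key : ∀ b ∈ pauliSubgroup σ k, b * b = 1 → ∀ d, AntiCommute b (σ j d) → ∀ c,
        HasExp K (b * σ l c) := by
      intro b hb hb2 d hbd c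
      have h1 := ih _ (mul_mem (imUnit_mem k) (mul_mem hb (mem d hjk)))
        (hbd.sq_mul hb2 (hσ.sq _ _))
      have hbl : Commute b (σ l c) := hσ.commute_of_le hb c le_rfl
      refine hasExp_of_mul h1 (hadj' j l hjl d c) ?_ ?_
      · refine .mul_right ?_ ((imUnit_commute _).mul_left (hbl.mul_left (hσ.comm j l _ _ hne)))
        exact .mul_left' (imUnit_commute _) (hbd.mul_left (Commute.refl _))
      · rw [mul_assoc, mul_assoc b, ← mul_assoc (σ j d), hσ.sq, one_mul]
    by_cases h0 : ∃ d, AntiCommute b (σ j d)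
    · obtain ⟨d, hd⟩ := h0
      exact key b hb hb2 d hd c
    · have hcomm : ∀ d, Commute b (σ j d) := fun d =>
        (hσ.commute_or_anti hb (mem d hjk)).resolve_right fun h => h0 ⟨d, h⟩
      have h1 : HasExp K (b * σ j 0 * σ l (c + 1)) := by
        refine key _ (mul_mem hb (mem 0 hjk)) ?_ 1 ?_ _
        · rw [mul_assoc, ← mul_assoc _ b, ← (hcomm 0).eq, mul_assoc b, hσ.sq, mul_one, hb2]
        · exact .mul_left' (hcomm 1) (hσ.anti j (by decide))
      refine hasExp_of_mul h1 (hadj' j l hjl 0 (c + 2)) ?_ ?_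
      · refine .mul_right' ?_ ?_
        · refine ((hcomm 0).mul_left (Commute.refl _)).mul_left (hσ.comm j l _ _ hne).symm
        · exact .mul_left' ((hbl _).mul_left (hσ.comm j l _ _ hne))
            (hσ.anti l (by clear * -; decide +revert))
      · have h2 := hσ.cyc l (c + 1)
        rw [show c + 1 + 1 = c + 2 by clear * -; decide +revert,
          show c + 1 + 2 = c by clear * -; decide +revert] at h2
        rw [mul_assoc, ← mul_assoc _ (σ j 0), ← (hσ.comm j l _ _ hne).eq, mul_assoc (σ j 0), h2,
          mul_assoc b, ← mul_assoc (σ j 0), hσ.sq, one_mul, mul_imUnit_mul]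

/-- Two anticommuting involutions of the Pauli group are conjugate by an element of `K` which
centralizes the centralizer of their product. -/
theorem exists_conj_eq {K : Subgroup Aˣ} (hσ : IsPauliSystem σ) {k : ℕ}
    (hK : ∀ a ∈ pauliSubgroup σ k, a * a = 1 → HasExp K a) {u w : Aˣ}
    (hu : u ∈ pauliSubgroup σ k) (hw : w ∈ pauliSubgroup σ k) (hu2 : u * u = 1) (hw2 : w * w = 1)
    (h : AntiCommute u w) :
    ∃ t ∈ K, (∀ b ∈ pauliSubgroup σ k, t * b * t⁻¹ ∈ pauliSubgroup σ k) ∧ t * u * t⁻¹ = w ∧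
      ∀ b, Commute (u * w) b → t * b * t⁻¹ = b := by
  have ha : imUnit A * (u * w) ∈ pauliSubgroup σ k :=
    mul_mem (imUnit_mem k) (mul_mem hu hw)
  obtain ⟨ha2, t, htK, ht⟩ := hK _ ha (h.sq_mul hu2 hw2)
  refine ⟨t, htK, fun b hb => ?_, ?_, fun b hb => ?_⟩
  · obtain hab | hab := hσ.commute_or_anti ha hb
    · rwa [mul_inv_eq_of_eq_mul (HasExp.quarterExp_commute ht hab)]
    · rw [HasExp.quarterExp_conj ha2 ht hab]
      exact mul_mem (imUnit_mem k) (mul_mem ha hb)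
  · rw [HasExp.quarterExp_conj ha2 ht, mul_assoc (imUnit A), imUnit_mul_imUnit_mul, h, neg_mul,
      neg_neg, mul_assoc, hu2, mul_one]
    exact .mul_left' (imUnit_commute u) (.mul_left' (Commute.refl u) h.symm)
  · exact mul_inv_eq_of_eq_mul
      (HasExp.quarterExp_commute ht ((imUnit_commute b).mul_left hb))

/-- Extend agreement of two Pauli systems by one qubit. -/
theorem exists_conj_eq_succ [Nontrivial A] {K : Subgroup Aˣ} (hσ : IsPauliSystem σ)
    (hK : ∀ a ∈ pauliSubgroup σ n, a * a = 1 → HasExp K a) (hτ : IsPauliSystem τ)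
    (hmem : ∀ j c, τ j c ∈ pauliSubgroup σ n) (k : Fin n) (heq : ∀ j < k, ∀ c, τ j c = σ j c) :
    ∃ t ∈ K, (∀ b ∈ pauliSubgroup σ n, t * b * t⁻¹ ∈ pauliSubgroup σ n) ∧
      ∀ j ≤ k, ∀ c, t * τ j c * t⁻¹ = σ j c := by
  have hσm : ∀ j c, σ j c ∈ pauliSubgroup σ n := fun j c => mem c j.2
  have hZ : ∃ t ∈ K, (∀ b ∈ pauliSubgroup σ n, t * b * t⁻¹ ∈ pauliSubgroup σ n) ∧
      t * τ k 2 * t⁻¹ = σ k 2 ∧ ∀ j < k, ∀ c, t * τ j c * t⁻¹ = σ j c := by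
    have hτc : ∀ j < k, ∀ c, Commute (τ k 2) (σ j c) := fun j hj c => by
      rw [← heq j hj]; exact hτ.comm k j _ _ hj.ne'
    have hσc : ∀ j < k, ∀ c d, Commute (σ k d) (σ j c) := fun j hj c d =>
      hσ.comm k j _ _ hj.ne'
    obtain hc | ha := hσ.commute_or_anti (hmem k 2) (hσm k 2)
    · have hu : ∃ u ∈ pauliSubgroup σ n, u * u = 1 ∧ AntiCommute (τ k 2) u ∧
          AntiCommute u (σ k 2) ∧ ∀ j < k, ∀ c, Commute u (σ j c) := by
        obtain hcx | hax := hσ.commute_or_anti (hmem k 2) (hσm k 0)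
        · have hex : ∃ j c, ¬ Commute (τ k 2) (σ j c) := by
            by_contra! hall
            exact (hτ.anti k (c := 2) (d := 0) (by decide)).not_commute
              (commute_of_forall (hmem k 0) fun j c _ => hall j c)
          obtain ⟨j, c, hjc⟩ := hex
          have hkj : k < j := by
            by_contra! hle
            obtain hlt | rfl := hle.lt_or_eq
            · exact hjc (hτc j hlt c)
            · have h1 : Commute (τ j 2) (σ j 1) := by
                have h2 := (hc.mul_right hcx)
                have h3 := hσ.cyc j 2
                change σ j 2 * σ j 0 = imUnit A * σ j 1 at h3
                rw [h3] at h2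
                simpa using ((imUnit_commute _).symm.inv_right).mul_right h2
              fin_cases c
              · exact hjc hcx
              · exact hjc h1
              · exact hjc hc
          have haj := (hσ.commute_or_anti (hmem k 2) (hσm j c)).resolve_left hjc
          refine ⟨σ k 0 * σ j c, mul_mem (hσm _ _) (hσm _ _), ?_, .mul_right' hcx haj,
            .mul_left (hσ.anti k (by decide)) (hσ.comm j k _ _ hkj.ne'), fun l hl d =>
            (hσc l hl d 0).mul_left (hσ.comm j l _ _ (hl.trans hkj).ne')⟩
          rw [mul_assoc, ← mul_assoc _ (σ k 0), ← (hσ.comm k j _ _ hkj.ne).eq,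
            mul_assoc (σ k 0), hσ.sq, mul_one, hσ.sq]
        · exact ⟨σ k 0, hσm _ _, hσ.sq _ _, hax, hσ.anti k (by decide), fun j hj c =>
            hσc j hj c 0⟩
      obtain ⟨u, hum, hu2, hτu, huσ, huc⟩ := hu
      obtain ⟨t, htK, htm, ht, htc⟩ := hσ.exists_conj_eq hK (hmem k 2) hum (hτ.sq _ _) hu2 hτu
      obtain ⟨s, hsK, hsm, hs, hsc⟩ := hσ.exists_conj_eq hK hum (hσm k 2) hu2 (hσ.sq _ _) huσ
      have hst : ∀ b, s * t * b * (s * t)⁻¹ = s * (t * b * t⁻¹) * s⁻¹ := fun b => by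
        simp only [mul_inv_rev, mul_assoc]
      refine ⟨s * t, mul_mem hsK htK, fun b hb => ?_, ?_, fun j hj c => ?_⟩
      · rw [hst]; exact hsm _ (htm b hb)
      · rw [hst, ht, hs]
      · rw [hst, heq j hj, htc _ ((hτc j hj c).mul_left (huc j hj c)),
          hsc _ ((huc j hj c).mul_left (hσc j hj c 2))]
    · obtain ⟨t, htK, htm, ht, htc⟩ :=
        hσ.exists_conj_eq hK (hmem k 2) (hσm k 2) (hτ.sq _ _) (hσ.sq _ _) ha
      refine ⟨t, htK, htm, ht, fun j hj c => ?_⟩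
      rw [heq j hj, htc _ ((hτc j hj c).mul_left (hσc j hj c 2))]
  obtain ⟨t, htK, htm, htz, htc⟩ := hZ
  have hρ := hτ.conj t
  have hX : ∃ s ∈ K, (∀ b ∈ pauliSubgroup σ n, s * b * s⁻¹ ∈ pauliSubgroup σ n) ∧
      s * (t * τ k 0 * t⁻¹) * s⁻¹ = σ k 0 ∧ s * σ k 2 * s⁻¹ = σ k 2 ∧
      ∀ j < k, ∀ c, s * σ j c * s⁻¹ = σ j c := by
    have hρm := htm _ (hmem k 0)
    have hρ2 := hρ.sq k 0
    have hρc : ∀ j < k, ∀ c, Commute (t * τ k 0 * t⁻¹) (σ j c) := fun j hj c => by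
      have := hρ.comm k j 0 c hj.ne'
      rwa [htc j hj c] at this
    have hρz : AntiCommute (t * τ k 0 * t⁻¹) (σ k 2) := by
      have := hρ.anti k (c := 0) (d := 2) (by decide)
      rwa [htz] at this
    have hσc : ∀ j < k, ∀ c d, Commute (σ k d) (σ j c) := fun j hj c d =>
      hσ.comm k j _ _ hj.ne'
    generalize t * τ k 0 * t⁻¹ = v at *
    obtain hc | ha := hσ.commute_or_anti hρm (hσm k 0)
    · have hy : AntiCommute v (σ k 1) := by
        have h1 : AntiCommute v (imUnit A * (σ k 2 * σ k 0)) :=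
          .mul_right' (imUnit_commute _).symm (hρz.mul_right hc)
        have h3 := hσ.cyc k 2
        change σ k 2 * σ k 0 = imUnit A * σ k 1 at h3
        rw [h3, imUnit_mul_imUnit_mul] at h1
        simpa [AntiCommute, neg_eq_iff_eq_neg] using h1
      obtain ⟨r, hrK, hrm, hr, hrc⟩ := hσ.exists_conj_eq hK hρm (hσm k 1) hρ2 (hσ.sq _ _) hy
      obtain ⟨s, hsK, hsm, hs, hsc⟩ := hσ.exists_conj_eq hK (hσm k 1) (hσm k 0) (hσ.sq _ _)
        (hσ.sq _ _) (hσ.anti k (by decide))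
      have hst : ∀ b, s * r * b * (s * r)⁻¹ = s * (r * b * r⁻¹) * s⁻¹ := fun b => by
        simp only [mul_inv_rev, mul_assoc]
      refine ⟨s * r, mul_mem hsK hrK, fun b hb => ?_, ?_, ?_, fun j hj c => ?_⟩
      · rw [hst]; exact hsm _ (hrm b hb)
      · rw [hst, hr, hs]
      · rw [hst, hrc, hsc]
        · exact (AntiCommute.commute_mul (hσ.anti k (by decide)) (hσ.anti k (by decide))).symm
        · exact (AntiCommute.commute_mul hρz.symm (hσ.anti k (by decide))).symm
      · rw [hst, hrc _ ((hρc j hj c).mul_left (hσc j hj c 1)),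
          hsc _ ((hσc j hj c 1).mul_left (hσc j hj c 0))]
    · obtain ⟨s, hsK, hsm, hs, hsc⟩ :=
        hσ.exists_conj_eq hK hρm (hσm k 0) hρ2 (hσ.sq _ _) ha
      refine ⟨s, hsK, hsm, hs, hsc _ ?_, fun j hj c => ?_⟩
      · exact (AntiCommute.commute_mul hρz.symm (hσ.anti k (by decide))).symm
      · rw [hsc _ ((hρc j hj c).mul_left (hσc j hj c 0))]
  obtain ⟨s, hsK, hsm, hsx, hsz, hsc⟩ := hX
  have hst : ∀ b, s * t * b * (s * t)⁻¹ = s * (t * b * t⁻¹) * s⁻¹ := fun b => by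
    simp only [mul_inv_rev, mul_assoc]
  refine ⟨s * t, mul_mem hsK htK, fun b hb => ?_, fun j hj c => ?_⟩
  · rw [hst]; exact hsm _ (htm b hb)
  obtain hj | rfl := hj.lt_or_eq
  · rw [hst, htc j hj, hsc j hj]
  · have h0 : s * t * τ j 0 * (s * t)⁻¹ = σ j 0 := by rw [hst, hsx]
    have h2 : s * t * τ j 2 * (s * t)⁻¹ = σ j 2 := by rw [hst, htz, hsz]
    have h1 : s * t * τ j 1 * (s * t)⁻¹ = σ j 1 := by
      have h3 := (hτ.conj (s * t)).cyc j 2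
      have h4 := hσ.cyc j 2
      change _ = imUnit A * (s * t * τ j 1 * (s * t)⁻¹) at h3
      change _ = imUnit A * σ j 1 at h4
      change s * t * τ j 2 * (s * t)⁻¹ * (s * t * τ j 0 * (s * t)⁻¹) = _ at h3
      rw [h0, h2] at h3
      exact mul_left_cancel (h3.symm.trans h4)
    fin_cases c
    · exact h0
    · exact h1
    · exact h2

/-- A Pauli system inside the Pauli group of another one is conjugate to it by an element of `K`. -/
theorem exists_conj_eq_of_mem [Nontrivial A] {K : Subgroup Aˣ} (hσ : IsPauliSystem σ)
    (hK : ∀ a ∈ pauliSubgroup σ n, a * a = 1 → HasExp K a) (hτ : IsPauliSystem τ)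
    (hmem : ∀ j c, τ j c ∈ pauliSubgroup σ n) :
    ∃ t ∈ K, ∀ j c, t * τ j c * t⁻¹ = σ j c := by
  suffices H : ∀ k ≤ n, ∃ t ∈ K, (∀ b ∈ pauliSubgroup σ n, t * b * t⁻¹ ∈ pauliSubgroup σ n) ∧
      ∀ j : Fin n, (j : ℕ) < k → ∀ c, t * τ j c * t⁻¹ = σ j c by
    obtain ⟨t, htK, -, ht⟩ := H n le_rfl
    exact ⟨t, htK, fun j => ht j j.2⟩
  intro k hk
  induction k with
  | zero => exact ⟨1, one_mem _, by simp, by simp⟩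
  | succ k ih =>
    obtain ⟨t, htK, htm, ht⟩ := ih (by omega)
    obtain ⟨s, hsK, hsm, hs⟩ := hσ.exists_conj_eq_succ hK (hτ.conj t)
      (fun j c => htm _ (hmem j c)) ⟨k, hk⟩ (fun j hj c => ht j hj c)
    have hst : ∀ b, s * t * b * (s * t)⁻¹ = s * (t * b * t⁻¹) * s⁻¹ := fun b => by
      simp only [mul_inv_rev, mul_assoc]
    refine ⟨s * t, mul_mem hsK htK, fun b hb => ?_, fun j hj c => ?_⟩
    · rw [hst]; exact hsm _ (htm b hb)
    · rw [hst]; exact hs j (Fin.le_def.2 (by simpa using Nat.lt_succ_iff.1 hj)) c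

/-- An endomorphism of the Pauli group fixing `i` is conjugation by an element of `K`. -/
theorem exists_eq_conj [Nontrivial A] {K : Subgroup Aˣ} (hσ : IsPauliSystem σ)
    (hK : ∀ a ∈ pauliSubgroup σ n, a * a = 1 → HasExp K a)
    {G : Subgroup Aˣ} (hG : pauliSubgroup σ n = G) (f : G →* G)
    (hf : ∀ u : G, (u : Aˣ) = imUnit A → f u = u) :
    ∃ t ∈ K, ∀ u, (f u : Aˣ) = t * u * t⁻¹ := by
  subst hG
  replace hf := hf ⟨imUnit A, imUnit_mem n⟩ rfl
  let s : Fin n → Fin 3 → pauliSubgroup σ n := fun j c => ⟨σ j c, mem c j.2⟩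
  have hτ : IsPauliSystem fun j c => (f (s j c) : Aˣ) := by
    refine ⟨fun j c => ?_, fun j c => ?_, fun j l c d h => ?_⟩
    · have h1 : s j c * s j c = 1 := Subtype.ext (hσ.sq j c)
      rw [← Subgroup.coe_mul, ← map_mul, h1, map_one, Subgroup.coe_one]
    · have h1 : s j c * s j (c + 1) = ⟨imUnit A, imUnit_mem n⟩ * s j (c + 2) :=
        Subtype.ext (hσ.cyc j c)
      rw [← Subgroup.coe_mul, ← map_mul, h1, map_mul, hf, Subgroup.coe_mul]
    · have h1 : Commute (s j c) (s l d) := Subtype.ext (hσ.comm j l c d h)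
      exact (h1.map f).map (Subgroup.subtype _)
  obtain ⟨t, htK, ht⟩ := hσ.exists_conj_eq_of_mem hK hτ fun j c => (f (s j c)).2
  refine ⟨t⁻¹, inv_mem htK, ?_⟩
  rintro ⟨u, hu⟩
  induction hu using Subgroup.closure_induction with
  | mem x hx =>
    obtain rfl | ⟨j, c, hj, rfl⟩ := hx
    · rw [hf, mul_imUnit, mul_assoc, mul_inv_cancel, mul_one]
    · change (f (s j c) : Aˣ) = t⁻¹ * σ j c * t⁻¹⁻¹
      rw [← ht j c]
      simp [mul_assoc]
  | one =>
    have : (⟨1, one_mem _⟩ : pauliSubgroup σ n) = 1 := rfl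
    simp [this]
  | mul x y hx hy ihx ihy =>
    have : (⟨x * y, mul_mem hx hy⟩ : pauliSubgroup σ n) = ⟨x, hx⟩ * ⟨y, hy⟩ := rfl
    rw [this, map_mul, Subgroup.coe_mul, ihx, ihy, conj_mul]
    rfl
  | inv x hx ih =>
    have : (⟨x⁻¹, inv_mem hx⟩ : pauliSubgroup σ n) = ⟨x, hx⟩⁻¹ := rfl
    rw [this, map_inv, Subgroup.coe_inv, ih]
    simp [mul_assoc]

end IsPauliSystem

end PauliSystem
section Tensor

/-- Transport of a square matrix along an equality of dimensions. -/
def castMat {m k : ℕ} (h : m = k) (M : Matrix (Fin m) (Fin m) ℂ) : Matrix (Fin k) (Fin k) ℂ :=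
  Matrix.reindex (finCongr h) (finCongr h) M

theorem castMat_castMat {m k l : ℕ} (h : m = k) (h' : k = l) (M : Matrix (Fin m) (Fin m) ℂ) :
    castMat h' (castMat h M) = castMat (h.trans h') M := by
  subst h h'; rfl

theorem castMat_one {m k : ℕ} (h : m = k) : castMat h (1 : Matrix (Fin m) (Fin m) ℂ) = 1 := by
  subst h; rfl

theorem castMat_mul {m k : ℕ} (h : m = k) (M N : Matrix (Fin m) (Fin m) ℂ) :
    castMat h (M * N) = castMat h M * castMat h N := by
  subst h; rfl

theorem castMat_add {m k : ℕ} (h : m = k) (M N : Matrix (Fin m) (Fin m) ℂ) :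
    castMat h (M + N) = castMat h M + castMat h N := by
  subst h; rfl

theorem castMat_smul {m k : ℕ} (h : m = k) (c : ℂ) (M : Matrix (Fin m) (Fin m) ℂ) :
    castMat h (c • M) = c • castMat h M := by
  subst h; rfl

theorem kron'_castMat_left {m m' k : ℕ} (h : m = m') (M : Matrix (Fin m) (Fin m) ℂ)
    (N : Matrix (Fin k) (Fin k) ℂ) :
    kron' (castMat h M) N = castMat (congrArg (· * k) h) (kron' M N) := by
  subst h; rfl

theorem kron'_castMat_right {m k k' : ℕ} (h : k = k') (M : Matrix (Fin m) (Fin m) ℂ)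
    (N : Matrix (Fin k) (Fin k) ℂ) :
    kron' M (castMat h N) = castMat (congrArg (m * ·) h) (kron' M N) := by
  subst h; rfl

theorem kron'_mul {m k : ℕ} (M M' : Matrix (Fin m) (Fin m) ℂ) (N N' : Matrix (Fin k) (Fin k) ℂ) :
    kron' M N * kron' M' N' = kron' (M * M') (N * N') := by
  simp [kron', Matrix.mul_kronecker_mul]

theorem kron'_one {m k : ℕ} :
    kron' (1 : Matrix (Fin m) (Fin m) ℂ) (1 : Matrix (Fin k) (Fin k) ℂ) = 1 := by
  simp [kron']

theorem kron'_add_left {m k : ℕ} (M M' : Matrix (Fin m) (Fin m) ℂ) (N : Matrix (Fin k) (Fin k) ℂ) :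
    kron' (M + M') N = kron' M N + kron' M' N := by
  ext; simp [kron', add_mul]

theorem kron'_add_right {m k : ℕ} (M : Matrix (Fin m) (Fin m) ℂ)
    (N N' : Matrix (Fin k) (Fin k) ℂ) : kron' M (N + N') = kron' M N + kron' M N' := by
  ext; simp [kron', mul_add]

theorem kron'_smul_left {m k : ℕ} (c : ℂ) (M : Matrix (Fin m) (Fin m) ℂ)
    (N : Matrix (Fin k) (Fin k) ℂ) : kron' (c • M) N = c • kron' M N := by
  ext; simp [kron', mul_assoc]

theorem kron'_smul_right {m k : ℕ} (c : ℂ) (M : Matrix (Fin m) (Fin m) ℂ)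
    (N : Matrix (Fin k) (Fin k) ℂ) : kron' M (c • N) = c • kron' M N := by
  ext; simp [kron', mul_left_comm]

theorem kron'_one_left {k : ℕ} (N : Matrix (Fin k) (Fin k) ℂ) :
    kron' (1 : Matrix (Fin 1) (Fin 1) ℂ) N = castMat (one_mul k).symm N := by
  ext i j
  simp only [kron', castMat, Matrix.reindex_apply, Matrix.submatrix_apply,
    Matrix.kroneckerMap_apply, finProdFinEquiv_symm_apply, finCongr_symm, finCongr_apply]
  rw [Subsingleton.elim i.divNat j.divNat, Matrix.one_apply_eq, one_mul]
  have h : ∀ x : Fin (1 * k), x.modNat = Fin.cast (one_mul k) x := fun x => by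
    ext
    have := x.2
    simp only [Fin.coe_modNat, Fin.val_cast]
    exact Nat.mod_eq_of_lt (by omega)
  rw [h, h]

theorem kron'_assoc {m k l : ℕ} (M : Matrix (Fin m) (Fin m) ℂ) (N : Matrix (Fin k) (Fin k) ℂ)
    (P : Matrix (Fin l) (Fin l) ℂ) :
    castMat (mul_assoc m k l) (kron' (kron' M N) P) = kron' M (kron' N P) := by
  ext i j
  simp only [kron', castMat, Matrix.reindex_apply, Matrix.submatrix_apply,
    Matrix.kroneckerMap_apply, finProdFinEquiv_symm_apply, finCongr_symm, finCongr_apply]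
  have h1 : ∀ x : Fin (m * (k * l)),
      (Fin.cast (mul_assoc m k l).symm x).divNat.divNat = x.divNat := fun x => by
    ext; simp [Fin.coe_divNat, Nat.div_div_eq_div_mul, mul_comm]
  have h2 : ∀ x : Fin (m * (k * l)),
      (Fin.cast (mul_assoc m k l).symm x).divNat.modNat = x.modNat.divNat := fun x => by
    ext; simp [Fin.coe_divNat, Fin.coe_modNat, Nat.mod_mul_left_div_self]
  have h3 : ∀ x : Fin (m * (k * l)),
      (Fin.cast (mul_assoc m k l).symm x).modNat = x.modNat.modNat := fun x => by
    ext; simp [Fin.coe_modNat]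
  rw [h1, h1, h2, h2, h3, h3, mul_assoc]

theorem castMat_kron'_assoc_right {m k l p q : ℕ} (h : m * (k * l * p) = q)
    (h' : m * (k * (l * p)) = q) (M : Matrix (Fin m) (Fin m) ℂ) (N : Matrix (Fin k) (Fin k) ℂ)
    (P : Matrix (Fin l) (Fin l) ℂ) (Q : Matrix (Fin p) (Fin p) ℂ) :
    castMat h (kron' M (kron' (kron' N P) Q)) = castMat h' (kron' M (kron' N (kron' P Q))) := by
  rw [← kron'_assoc N, kron'_castMat_right, castMat_castMat]

theorem castMat_kron'_assoc_left {m k l p q : ℕ} (h : m * (k * l * p) = q)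
    (h' : m * k * (l * p) = q) (M : Matrix (Fin m) (Fin m) ℂ) (N : Matrix (Fin k) (Fin k) ℂ)
    (P : Matrix (Fin l) (Fin l) ℂ) (Q : Matrix (Fin p) (Fin p) ℂ) :
    castMat h (kron' M (kron' (kron' N P) Q)) = castMat h' (kron' (kron' M N) (kron' P Q)) := by
  subst h
  rw [castMat_kron'_assoc_right rfl (by simp only [mul_assoc]), ← kron'_assoc M N, castMat_castMat]

theorem embed_eq (a c b n : ℕ) (h : a + c + b = n) (G : Matrix (Fin (2 ^ c)) (Fin (2 ^ c)) ℂ) :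
    embed a c b n h G = castMat (by subst h; rw [pow_add, pow_add, mul_assoc])
      (kron' (1 : Matrix (Fin (2 ^ a)) (Fin (2 ^ a)) ℂ)
        (kron' G (1 : Matrix (Fin (2 ^ b)) (Fin (2 ^ b)) ℂ))) := rfl

section

variable {a c b n : ℕ} (h : a + c + b = n)

theorem embed_one : embed a c b n h 1 = 1 := by
  rw [embed_eq, kron'_one, kron'_one, castMat_one]

theorem embed_mul (G G' : Matrix (Fin (2 ^ c)) (Fin (2 ^ c)) ℂ) :
    embed a c b n h (G * G') = embed a c b n h G * embed a c b n h G' := by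
  simp only [embed_eq, ← castMat_mul, kron'_mul, mul_one]

theorem embed_add (G G' : Matrix (Fin (2 ^ c)) (Fin (2 ^ c)) ℂ) :
    embed a c b n h (G + G') = embed a c b n h G + embed a c b n h G' := by
  simp only [embed_eq, ← castMat_add, kron'_add_left, kron'_add_right]

theorem embed_smul (r : ℂ) (G : Matrix (Fin (2 ^ c)) (Fin (2 ^ c)) ℂ) :
    embed a c b n h (r • G) = r • embed a c b n h G := by
  simp only [embed_eq, ← castMat_smul, kron'_smul_left, kron'_smul_right]

end

theorem one_pow_succ (a : ℕ) : (1 : Matrix (Fin (2 ^ (a + 1))) (Fin (2 ^ (a + 1))) ℂ) =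
    castMat (pow_succ' 2 a).symm (kron' (1 : Matrix (Fin 2) (Fin 2) ℂ) 1) := by
  rw [kron'_one, castMat_one]

theorem one_pow_succ' (a : ℕ) : (1 : Matrix (Fin (2 ^ (a + 1))) (Fin (2 ^ (a + 1))) ℂ) =
    castMat (pow_succ 2 a).symm (kron' 1 (1 : Matrix (Fin 2) (Fin 2) ℂ)) := by
  rw [kron'_one, castMat_one]

theorem tensorPow_succ (n : ℕ) (P : Fin (n + 1) → Matrix (Fin 2) (Fin 2) ℂ) :
    tensorPow (n + 1) P = castMat (pow_succ' 2 n).symm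
      (kron' (P 0) (tensorPow n fun i => P i.succ)) := rfl

theorem tensorPow_one (n : ℕ) : tensorPow n 1 = 1 := by
  induction n with
  | zero => rfl
  | succ n ih =>
    rw [tensorPow_succ]
    change castMat _ (kron' 1 (tensorPow n 1)) = 1
    rw [ih, ← one_pow_succ]

theorem tensorPow_mul (n : ℕ) (P Q : Fin n → Matrix (Fin 2) (Fin 2) ℂ) :
    tensorPow n (P * Q) = tensorPow n P * tensorPow n Q := by
  induction n with
  | zero => exact (mul_one _).symm
  | succ n ih =>
    rw [tensorPow_succ, tensorPow_succ, tensorPow_succ, ← castMat_mul, kron'_mul, ← ih]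
    rfl

theorem embed_succ (a c b n : ℕ) (h : a + c + b = n) (h' : a + 1 + c + b = n + 1)
    (G : Matrix (Fin (2 ^ c)) (Fin (2 ^ c)) ℂ) :
    embed (a + 1) c b (n + 1) h' G = castMat (pow_succ' 2 n).symm
      (kron' (1 : Matrix (Fin 2) (Fin 2) ℂ) (embed a c b n h G)) := by
  rw [embed_eq, embed_eq, one_pow_succ, kron'_castMat_left, kron'_castMat_right,
    ← kron'_assoc (1 : Matrix (Fin 2) (Fin 2) ℂ) (1 : Matrix (Fin (2 ^ a)) (Fin (2 ^ a)) ℂ)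
      (kron' G 1)]
  simp only [castMat_castMat]

theorem embed_eq_tensorPow (a b n : ℕ) (h : a + 1 + b = n) (G : Matrix (Fin 2) (Fin 2) ℂ) :
    embed a 1 b n h G = tensorPow n (Pi.mulSingle ⟨a, by omega⟩ G) := by
  induction a generalizing n with
  | zero =>
    obtain rfl : n = b + 1 := by omega
    rw [embed_eq, tensorPow_succ]
    have h1 : (fun i : Fin b =>
        (Pi.mulSingle (⟨0, by omega⟩ : Fin (b + 1)) G : Fin (b + 1) → _) i.succ) = 1 := by
      funext i
      exact Pi.mulSingle_eq_of_ne (by simp [Fin.ext_iff]) _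
    have h2 : (Pi.mulSingle (⟨0, by omega⟩ : Fin (b + 1)) G : Fin (b + 1) → _) 0 = G :=
      Pi.mulSingle_eq_same _ _
    rw [h1, h2, tensorPow_one]
    have h3 := kron'_one_left (kron' G (1 : Matrix (Fin (2 ^ b)) (Fin (2 ^ b)) ℂ))
    change castMat _ (kron' (1 : Matrix (Fin 1) (Fin 1) ℂ) (kron' G 1)) = _
    rw [h3, castMat_castMat]
  | succ a ih =>
    obtain ⟨n, rfl⟩ : ∃ m, n = m + 1 := ⟨n - 1, by omega⟩
    rw [embed_succ a 1 b n (by omega), ih, tensorPow_succ]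
    congr 2
    congr 1
    funext i
    by_cases hi : i = ⟨a, by omega⟩
    · subst hi
      simp [Fin.succ]
    · rw [Pi.mulSingle_eq_of_ne hi, Pi.mulSingle_eq_of_ne]
      simpa [Fin.ext_iff] using hi

theorem embed_kron'_one (a b n : ℕ) (h : a + 2 + b = n) (h' : a + 1 + (b + 1) = n)
    (G : Matrix (Fin 2) (Fin 2) ℂ) :
    embed a 2 b n h (kron' G (1 : Matrix (Fin 2) (Fin 2) ℂ)) = embed a 1 (b + 1) n h' G := by
  rw [embed_eq, embed_eq, one_pow_succ b, kron'_castMat_right, kron'_castMat_right,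
    castMat_castMat]
  exact castMat_kron'_assoc_right _ _ 1 G (1 : Matrix (Fin 2) (Fin 2) ℂ) 1

theorem embed_one_kron' (a b n : ℕ) (h : a + 2 + b = n) (h' : a + 1 + 1 + b = n)
    (G : Matrix (Fin 2) (Fin 2) ℂ) :
    embed a 2 b n h (kron' (1 : Matrix (Fin 2) (Fin 2) ℂ) G) = embed (a + 1) 1 b n h' G := by
  rw [embed_eq, embed_eq, one_pow_succ' a, kron'_castMat_left, castMat_castMat]
  exact castMat_kron'_assoc_left _ _ 1 (1 : Matrix (Fin 2) (Fin 2) ℂ) G 1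

theorem gCZ_mul_X : gCZ * kron' PX (1 : Matrix (Fin 2) (Fin 2) ℂ) =
    kron' PX (1 : Matrix (Fin 2) (Fin 2) ℂ) * kron' (1 : Matrix (Fin 2) (Fin 2) ℂ) PZ * gCZ := by
  rw [kron'_mul]
  ext i j
  fin_cases i <;> fin_cases j <;>
    simp [Matrix.mul_apply, Fin.sum_univ_four, gCZ, PX, PZ, kron', finProdFinEquiv, Fin.divNat,
      Fin.modNat, Matrix.one_apply]

/-- The Pauli matrices `X, Y, Z`, indexed by `0, 1, 2`. -/
def pauli : Fin 3 → Matrix (Fin 2) (Fin 2) ℂ := ![PX, PY, PZ]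

theorem pauli_mul_self (c : Fin 3) : pauli c * pauli c = 1 := by
  fin_cases c <;> simp [pauli, PX, PY, PZ, Matrix.one_fin_two]

theorem pauli_mul_succ (c : Fin 3) : pauli c * pauli (c + 1) = Complex.I • pauli (c + 2) := by
  fin_cases c <;> simp [pauli, PX, PY, PZ]

/-- The Pauli matrix `pauli c` acting on the `j`-th of `n` qubits. -/
def sitePauli (n : ℕ) (j : Fin n) (c : Fin 3) : GL (Fin (2 ^ n)) ℂ where
  val := tensorPow n (Pi.mulSingle j (pauli c))
  inv := tensorPow n (Pi.mulSingle j (pauli c))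
  val_inv := by rw [← tensorPow_mul, ← Pi.mulSingle_mul, pauli_mul_self, Pi.mulSingle_one,
    tensorPow_one]
  inv_val := by rw [← tensorPow_mul, ← Pi.mulSingle_mul, pauli_mul_self, Pi.mulSingle_one,
    tensorPow_one]

theorem val_sitePauli (n : ℕ) (j : Fin n) (c : Fin 3) :
    (sitePauli n j c : Matrix (Fin (2 ^ n)) (Fin (2 ^ n)) ℂ) =
      tensorPow n (Pi.mulSingle j (pauli c)) := rfl

theorem val_sitePauli_eq_embed {n a b : ℕ} (h : a + 1 + b = n) (c : Fin 3) :
    (sitePauli n ⟨a, by omega⟩ c : Matrix (Fin (2 ^ n)) (Fin (2 ^ n)) ℂ) =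
      embed a 1 b n h (pauli c) := by
  rw [embed_eq_tensorPow, val_sitePauli]

theorem isPauliSystem_sitePauli (n : ℕ) : IsPauliSystem (sitePauli n) where
  sq j c := Units.ext (sitePauli n j c).val_inv
  cyc j c := by
    refine Units.ext ?_
    obtain ⟨a, ha⟩ := j
    have h : a + 1 + (n - 1 - a) = n := by omega
    rw [Units.val_mul, Units.val_mul, val_sitePauli_eq_embed h, val_sitePauli_eq_embed h,
      val_sitePauli_eq_embed h, ← embed_mul, val_imUnit, ← Algebra.smul_def, ← embed_smul]
    exact congrArg _ (pauli_mul_succ c)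
  comm j l c d h := by
    refine Units.ext ?_
    rw [Units.val_mul, Units.val_mul, val_sitePauli, val_sitePauli, ← tensorPow_mul,
      ← tensorPow_mul]
    exact congrArg _ (Pi.mulSingle_commute (f := fun _ => Matrix (Fin 2) (Fin 2) ℂ) h
      (pauli c) (pauli d)).eq

theorem mem_pauliSubgroup_of_val_eq_smul {n : ℕ} {u : GL (Fin (2 ^ n)) ℂ} {r : ℂ}
    (hr : r ∈ ({1, -1, Complex.I, -Complex.I} : Set ℂ)) {M : Matrix (Fin (2 ^ n)) (Fin (2 ^ n)) ℂ}
    (hu : (u : Matrix (Fin (2 ^ n)) (Fin (2 ^ n)) ℂ) = r • M) {v : GL (Fin (2 ^ n)) ℂ}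
    (hv : v ∈ pauliSubgroup (sitePauli n) n) (hvM : (v : Matrix (Fin (2 ^ n)) (Fin (2 ^ n)) ℂ) = M) :
    u ∈ pauliSubgroup (sitePauli n) n := by
  subst hvM
  have hi := mul_mem (IsPauliSystem.imUnit_mem n) hv
  obtain rfl | rfl | rfl | rfl := hr
  · rwa [show u = v from Units.ext (by rw [hu, one_smul])]
  · rw [show u = -v from Units.ext (by rw [hu, Units.val_neg, neg_one_smul])]
    exact IsPauliSystem.neg_mem hv
  · rwa [show u = imUnit _ * v from Units.ext (by
      rw [hu, Units.val_mul, val_imUnit, ← Algebra.smul_def])]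
  · rw [show u = -(imUnit _ * v) from Units.ext (by
      rw [hu, Units.val_neg, Units.val_mul, val_imUnit, ← Algebra.smul_def, neg_smul])]
    exact IsPauliSystem.neg_mem hi

theorem exists_mem_val_eq_tensorPow {n : ℕ} {P : Fin n → Matrix (Fin 2) (Fin 2) ℂ}
    (hP : ∀ i, P i ∈ ({1, PX, PY, PZ} : Set (Matrix (Fin 2) (Fin 2) ℂ))) :
    ∃ v ∈ pauliSubgroup (sitePauli n) n,
      (v : Matrix (Fin (2 ^ n)) (Fin (2 ^ n)) ℂ) = tensorPow n P := by
  suffices H : ∀ s : Finset (Fin n), ∃ v ∈ pauliSubgroup (sitePauli n) n,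
      (v : Matrix (Fin (2 ^ n)) (Fin (2 ^ n)) ℂ) =
        tensorPow n (fun j => if j ∈ s then P j else 1) by
    simpa using H Finset.univ
  intro s
  induction s using Finset.induction_on with
  | empty => exact ⟨1, one_mem _, (tensorPow_one n).symm⟩
  | insert j s hj ih =>
    obtain ⟨v, hv, hvs⟩ := ih
    have hmul : (fun l => if l ∈ insert j s then P l else 1) =
        Pi.mulSingle j (P j) * fun l => if l ∈ s then P l else 1 := by
      funext l
      by_cases hl : l = j
      · subst hl; simp [hj]
      · simp [hl]
    have hw : ∃ w ∈ pauliSubgroup (sitePauli n) n,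
        (w : Matrix (Fin (2 ^ n)) (Fin (2 ^ n)) ℂ) = tensorPow n (Pi.mulSingle j (P j)) := by
      obtain h | h | h | h := hP j
      · exact ⟨1, one_mem _, by rw [h, Pi.mulSingle_one, tensorPow_one, Units.val_one]⟩
      · exact ⟨sitePauli n j 0, IsPauliSystem.mem 0 j.2, by rw [h]; rfl⟩
      · exact ⟨sitePauli n j 1, IsPauliSystem.mem 1 j.2, by rw [h]; rfl⟩
      · exact ⟨sitePauli n j 2, IsPauliSystem.mem 2 j.2, by rw [h]; rfl⟩
    obtain ⟨w, hw, hwj⟩ := hw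
    exact ⟨w * v, mul_mem hw hv, by rw [hmul, tensorPow_mul, Units.val_mul, hwj, hvs]⟩

theorem pauliSubgroup_sitePauli (n : ℕ) : pauliSubgroup (sitePauli n) n = PauliGroup n := by
  refine le_antisymm ((Subgroup.closure_le _).2 ?_) ((Subgroup.closure_le _).2 ?_)
  · rintro u (rfl | ⟨j, c, -, rfl⟩)
    · refine Subgroup.subset_closure ⟨Complex.I, 1, by simp, by simp, ?_⟩
      rw [val_imUnit, tensorPow_one, Algebra.algebraMap_eq_smul_one]
    · refine Subgroup.subset_closure ⟨1, Pi.mulSingle j (pauli c), by simp, fun i => ?_, ?_⟩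
      · by_cases hi : i = j
        · subst hi
          rw [Pi.mulSingle_eq_same]
          fin_cases c <;> simp [pauli]
        · rw [Pi.mulSingle_eq_of_ne hi]
          exact Or.inl rfl
      · rw [one_smul, val_sitePauli]
  · rintro u ⟨r, P, hr, hP, hu⟩
    obtain ⟨v, hv, hvP⟩ := exists_mem_val_eq_tensorPow hP
    exact mem_pauliSubgroup_of_val_eq_smul hr hu hv hvP

theorem omega_eq : ω = (Real.sqrt 2 : ℂ)⁻¹ * (1 + Complex.I) := by
  have h : (Complex.I * Real.pi / 4 : ℂ) = ((Real.pi / 4 : ℝ) : ℂ) * Complex.I := by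
    push_cast; ring
  have h2 : (Real.sqrt 2 : ℂ) * Real.sqrt 2 = 2 := by
    rw [← Complex.ofReal_mul, Real.mul_self_sqrt (by norm_num)]; norm_num
  have h3 : (Real.sqrt 2 : ℂ) ≠ 0 := by
    intro h0; rw [h0] at h2; norm_num at h2
  rw [ω, h, Complex.exp_mul_I, ← Complex.ofReal_cos, ← Complex.ofReal_sin, Real.cos_pi_div_four,
    Real.sin_pi_div_four]
  push_cast
  field_simp
  linear_combination (1 + Complex.I) * h2

theorem gH_mul_self : gH * gH = 1 := by
  rw [gH, smul_mul_smul_comm, inv_sqrt_two_mul_self]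
  ext i j
  fin_cases i <;> fin_cases j <;> norm_num

theorem gS_mul_inv : gS * !![1, 0; 0, -Complex.I] = 1 := by
  simp [gS, Matrix.one_fin_two]

theorem gCZ_mul_self : gCZ * gCZ = 1 := by
  ext i j
  fin_cases i <;> fin_cases j <;> simp [gCZ, Matrix.mul_apply, Fin.sum_univ_four]

/-- An invertible generator of the Clifford group gives an element of the group. -/
theorem exists_mem_cliffordGroup {n a c b : ℕ} (h : a + c + b = n)
    {G G' : Matrix (Fin (2 ^ c)) (Fin (2 ^ c)) ℂ} (hG : G * G' = 1)
    (hmem : embed a c b n h G ∈ CliffordGenSet n) :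
    ∃ t ∈ CliffordGroup n, (t : Matrix (Fin (2 ^ n)) (Fin (2 ^ n)) ℂ) = embed a c b n h G := by
  refine ⟨⟨embed a c b n h G, embed a c b n h G', ?_, ?_⟩, Subgroup.subset_closure hmem, rfl⟩
  · rw [← embed_mul, hG, embed_one]
  · rw [← embed_mul, mul_eq_one_comm.1 hG, embed_one]

theorem exists_mem_cliffordGroup_omega (n : ℕ) :
    ∃ t ∈ CliffordGroup n, (t : Matrix (Fin (2 ^ n)) (Fin (2 ^ n)) ℂ) = ω • 1 := by
  have hω : ω ≠ 0 := Complex.exp_ne_zero _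
  exact ⟨⟨ω • 1, ω⁻¹ • 1, by simp [smul_smul, hω], by simp [smul_smul, hω]⟩,
    Subgroup.subset_closure (Or.inl (Or.inl rfl)), rfl⟩

theorem hasExp_one (n : ℕ) : HasExp (CliffordGroup n) 1 := by
  obtain ⟨t, ht, h⟩ := exists_mem_cliffordGroup_omega n
  refine ⟨mul_one _, t, ht, ?_⟩
  rw [h, quarterExp, omega_eq, Units.val_one, mul_smul, add_smul, one_smul]

theorem hasExp_Z {n : ℕ} (j : Fin n) : HasExp (CliffordGroup n) (sitePauli n j 2) := by
  obtain ⟨a, ha⟩ := j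
  have h : a + 1 + (n - 1 - a) = n := by omega
  obtain ⟨t, ht, hω⟩ := exists_mem_cliffordGroup_omega n
  obtain ⟨s, hs, hS⟩ := exists_mem_cliffordGroup h (G := gS) gS_mul_inv
    (Or.inl (Or.inr ⟨_, _, h, Or.inr rfl⟩))
  refine HasExp.of_neg ⟨?_, t⁻¹ * s, mul_mem (inv_mem ht) hs, ?_⟩
  · rw [neg_mul_neg, (isPauliSystem_sitePauli n).sq]
  · rw [Units.val_mul, Units.inv_mul_eq_iff_eq_mul, hω, hS, quarterExp, Units.val_neg,
      val_sitePauli_eq_embed h, smul_mul_assoc, one_mul, ← embed_one h, smul_neg, ← neg_smul,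
      ← embed_smul, ← embed_add, ← embed_smul, ← embed_smul]
    congr 1
    rw [smul_smul, omega_eq, mul_right_comm, inv_sqrt_two_mul_self]
    change gS = (2⁻¹ * (1 + Complex.I)) • ((1 : Matrix (Fin 2) (Fin 2) ℂ) + -Complex.I • PZ)
    ext i j
    fin_cases i <;> fin_cases j <;> (simp [gS, PZ]; try ring_nf) <;> simp <;> ring

theorem hasExp_X {n : ℕ} (j : Fin n) : HasExp (CliffordGroup n) (sitePauli n j 0) := by
  have hZ := hasExp_Z j
  obtain ⟨a, ha⟩ := j
  have h : a + 1 + (n - 1 - a) = n := by omega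
  obtain ⟨t, ht, hH⟩ := exists_mem_cliffordGroup h (G := gH) gH_mul_self
    (Or.inl (Or.inr ⟨_, _, h, Or.inl rfl⟩))
  have hc : t * sitePauli n ⟨a, ha⟩ 2 * t⁻¹ = sitePauli n ⟨a, ha⟩ 0 := by
    rw [mul_inv_eq_iff_eq_mul]
    refine Units.ext ?_
    rw [Units.val_mul, Units.val_mul, val_sitePauli_eq_embed h, val_sitePauli_eq_embed h, hH,
      ← embed_mul, ← embed_mul]
    congr 1
    change gH * PZ = PX * gH
    ext i j
    fin_cases i <;> fin_cases j <;> simp [gH, PZ, PX]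
  rw [← hc]
  exact hZ.conj ht

theorem hasExp_sitePauli {n : ℕ} (j : Fin n) (c : Fin 3) :
    HasExp (CliffordGroup n) (sitePauli n j c) := by
  fin_cases c
  · exact hasExp_X j
  · exact IsPauliSystem.hasExp_of_mul (hasExp_Z j) (hasExp_X j)
      ((isPauliSystem_sitePauli n).anti j (by decide)) ((isPauliSystem_sitePauli n).cyc j 2)
  · exact hasExp_Z j

theorem hasExp_XZ {n : ℕ} (j l : Fin n) (hl : (l : ℕ) = j + 1) :
    HasExp (CliffordGroup n) (sitePauli n j 0 * sitePauli n l 2) := by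
  have hX := hasExp_X j
  obtain ⟨a, ha⟩ := j
  obtain ⟨l, ha'⟩ := l
  obtain rfl : l = a + 1 := hl
  have h : a + 2 + (n - 2 - a) = n := by omega
  have h1 : a + 1 + (n - 2 - a + 1) = n := by omega
  have h2 : a + 1 + 1 + (n - 2 - a) = n := by omega
  obtain ⟨t, ht, hC⟩ := exists_mem_cliffordGroup h (G := gCZ) gCZ_mul_self
    (Or.inr ⟨_, _, h, rfl⟩)
  have hc : t * sitePauli n ⟨a, ha⟩ 0 * t⁻¹ =
      sitePauli n ⟨a, ha⟩ 0 * sitePauli n ⟨a + 1, ha'⟩ 2 := by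
    rw [mul_inv_eq_iff_eq_mul]
    refine Units.ext ?_
    rw [Units.val_mul, Units.val_mul, Units.val_mul, val_sitePauli_eq_embed h1,
      val_sitePauli_eq_embed h2, hC, ← embed_kron'_one a (n - 2 - a) n h h1,
      ← embed_one_kron' a (n - 2 - a) n h h2, ← embed_mul, ← embed_mul, ← embed_mul]
    exact congrArg _ gCZ_mul_X
  rw [← hc]
  exact hX.conj ht

end Tensor

/-- Every automorphism of the Pauli group fixing scalars is realized by
conjugation by some Clifford operator. -/
theorem automorphism_is_clifford_conj (n : ℕ)
    (φ : PauliGroup n ≃* PauliGroup n)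
    (hfix : ∀ lam ∈ ({1, -1, Complex.I, -Complex.I} : Set ℂ),
      ∀ u : PauliGroup n,
        ((u : GL (Fin (2 ^ n)) ℂ) : Matrix (Fin (2 ^ n)) (Fin (2 ^ n)) ℂ)
          = lam • (1 : Matrix (Fin (2 ^ n)) (Fin (2 ^ n)) ℂ) → φ u = u) :
    ∃ C ∈ CliffordGroup n, ∀ u : PauliGroup n,
      ((φ u : PauliGroup n) : GL (Fin (2 ^ n)) ℂ)
        = C * (u : GL (Fin (2 ^ n)) ℂ) * C⁻¹ := by
  obtain ⟨C, hC, h⟩ := (isPauliSystem_sitePauli n).exists_eq_conj (K := CliffordGroup n)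
    ((isPauliSystem_sitePauli n).hasExp_of_mem (hasExp_one n) hasExp_sitePauli hasExp_XZ n le_rfl)
    (pauliSubgroup_sitePauli n) φ.toMonoidHom fun u hu =>
      hfix Complex.I (by simp) u (by rw [hu, val_imUnit, Algebra.algebraMap_eq_smul_one])
  exact ⟨C, hC, h⟩
end
end

section
/- For every n ≥ 0, the Clifford group Clifford(n) is a finite group. -/
open scoped Matrix Kronecker

noncomputable section

/-- The single-qubit Pauli operator `X ^ a * Z ^ b`, with rows and columns indexed by bits. -/
def pauliXZ (a b : Bool) : Matrix Bool Bool ℂ :=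
  Matrix.of fun u v => if u = xor v a then (if b && v then -1 else 1) else 0

/-- The single-qubit Pauli operators with phases the fourth roots of unity. -/
def phasedPaulis : Set (Matrix Bool Bool ℂ) :=
  {M | ∃ (l : ℂ) (a b : Bool), l ^ 4 = 1 ∧ M = l • pauliXZ a b}

lemma finite_setOf_pow_eq_one {k : ℕ} (hk : 0 < k) : {l : ℂ | l ^ k = 1}.Finite := by
  refine (Polynomial.nthRoots k (1 : ℂ)).toFinset.finite_toSet.subset fun l hl => ?_
  simpa [Polynomial.mem_nthRoots hk] using hl

lemma finite_phasedPaulis : phasedPaulis.Finite := by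
  refine (((finite_setOf_pow_eq_one four_pos).prod
    (Set.finite_univ (α := Bool × Bool))).image
      fun x => x.1 • pauliXZ x.2.1 x.2.2).subset ?_
  rintro _ ⟨l, a, b, hl, rfl⟩
  exact ⟨(l, a, b), ⟨hl, trivial⟩, rfl⟩

lemma pauliXZ_mem_phasedPaulis (a b : Bool) : pauliXZ a b ∈ phasedPaulis :=
  ⟨1, a, b, one_pow 4, (one_smul _ _).symm⟩

/-- The tensor product of the matrices `P i`, where `P i` acts on the bit of weight `2 ^ i`. -/
def bitTensor (n : ℕ) (P : ℕ → Matrix Bool Bool ℂ) : Matrix (Fin (2 ^ n)) (Fin (2 ^ n)) ℂ :=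
  Matrix.of fun u v => ∏ i ∈ Finset.range n, P i (u.val.testBit i) (v.val.testBit i)

lemma bitTensor_congr {n : ℕ} {P Q : ℕ → Matrix Bool Bool ℂ} (h : ∀ i < n, P i = Q i) :
    bitTensor n P = bitTensor n Q := by
  ext u v
  exact Finset.prod_congr rfl fun i hi => congrFun₂ (h i (Finset.mem_range.1 hi)) _ _

/-- The set of `n`-qubit Pauli operators. -/
def bitPaulis (n : ℕ) : Set (Matrix (Fin (2 ^ n)) (Fin (2 ^ n)) ℂ) :=
  {M | ∃ P : ℕ → Matrix Bool Bool ℂ, (∀ i, P i ∈ phasedPaulis) ∧ M = bitTensor n P}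

lemma finite_bitPaulis (n : ℕ) : (bitPaulis n).Finite := by
  refine ((Set.Finite.pi' fun _ : Fin n => finite_phasedPaulis).image
    fun P => bitTensor n fun i => if h : i < n then P ⟨i, h⟩ else 1).subset ?_
  rintro _ ⟨P, hP, rfl⟩
  exact ⟨fun i => P i, fun i => hP i, bitTensor_congr fun i hi => by simp [hi]⟩

/-- Splitting the basis states of `a + c + b` qubits. -/
def splitEquiv (a c b n : ℕ) (h : a + c + b = n) :
    Fin (2 ^ a) × Fin (2 ^ c) × Fin (2 ^ b) ≃ Fin (2 ^ n) :=
  ((Equiv.refl _).prodCongr finProdFinEquiv).trans (finProdFinEquiv.trans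
    (finCongr (by subst h; rw [pow_add, pow_add, mul_assoc])))

lemma splitEquiv_val (a c b n : ℕ) (h : a + c + b = n)
    (x : Fin (2 ^ a)) (y : Fin (2 ^ c)) (z : Fin (2 ^ b)) :
    (splitEquiv a c b n h (x, y, z)).val = 2 ^ b * (2 ^ c * x.val + y.val) + z.val := by
  simp [splitEquiv]
  ring

lemma embed_eq_reindex (a c b n : ℕ) (h : a + c + b = n)
    (G : Matrix (Fin (2 ^ c)) (Fin (2 ^ c)) ℂ) :
    embed a c b n h G =
      Matrix.reindex (splitEquiv a c b n h) (splitEquiv a c b n h) (1 ⊗ₖ (G ⊗ₖ 1)) :=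
  rfl

lemma bitTensor_eq_reindex (a c b n : ℕ) (h : a + c + b = n) (P : ℕ → Matrix Bool Bool ℂ) :
    bitTensor n P = Matrix.reindex (splitEquiv a c b n h) (splitEquiv a c b n h)
      (bitTensor a (fun i => P (b + c + i)) ⊗ₖ
        (bitTensor c (fun i => P (b + i)) ⊗ₖ bitTensor b P)) := by
  ext u v
  obtain ⟨⟨x, y, z⟩, rfl⟩ := (splitEquiv a c b n h).surjective u
  obtain ⟨⟨x', y', z'⟩, rfl⟩ := (splitEquiv a c b n h).surjective v
  have hn : n = b + c + a := by omega
  simp only [Matrix.reindex_apply, Matrix.submatrix_apply, Equiv.symm_apply_apply,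
    Matrix.kroneckerMap_apply, bitTensor, Matrix.of_apply, splitEquiv_val]
  conv_lhs => rw [hn, Finset.prod_range_add, Finset.prod_range_add, mul_comm]
  congr 1
  · refine Finset.prod_congr rfl fun i _ => ?_
    rw [Nat.testBit_two_pow_mul_add _ z.2, Nat.testBit_two_pow_mul_add _ z'.2,
      if_neg (by omega), if_neg (by omega), Nat.testBit_two_pow_mul_add _ y.2,
      Nat.testBit_two_pow_mul_add _ y'.2, if_neg (by omega), if_neg (by omega),
      show b + c + i - b - c = i by omega]
  · rw [mul_comm]
    congr 1
    · refine Finset.prod_congr rfl fun i hi => ?_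
      have := Finset.mem_range.1 hi
      rw [Nat.testBit_two_pow_mul_add _ z.2, Nat.testBit_two_pow_mul_add _ z'.2,
        if_neg (by omega), if_neg (by omega), Nat.testBit_two_pow_mul_add _ y.2,
        Nat.testBit_two_pow_mul_add _ y'.2, if_pos (by omega), if_pos (by omega),
        show b + i - b = i by omega]
    · refine Finset.prod_congr rfl fun i hi => ?_
      have := Finset.mem_range.1 hi
      rw [Nat.testBit_two_pow_mul_add _ z.2, Nat.testBit_two_pow_mul_add _ z'.2,
        if_pos this, if_pos this]

/-- `G` maps Pauli operators to Pauli operators under conjugation. -/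
def NormalizesPaulis {n : ℕ} (G : Matrix (Fin (2 ^ n)) (Fin (2 ^ n)) ℂ) : Prop :=
  ∀ M ∈ bitPaulis n, ∃ M' ∈ bitPaulis n, G * M = M' * G

lemma NormalizesPaulis.embed {a c b n : ℕ} (h : a + c + b = n)
    {G : Matrix (Fin (2 ^ c)) (Fin (2 ^ c)) ℂ} (hG : NormalizesPaulis G) :
    NormalizesPaulis (embed a c b n h G) := by
  rintro _ ⟨P, hP, rfl⟩
  obtain ⟨_, ⟨Q, hQ, rfl⟩, hGQ⟩ := hG _ ⟨fun i => P (b + i), fun i => hP _, rfl⟩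
  let R : ℕ → Matrix Bool Bool ℂ := fun i => if b ≤ i ∧ i < b + c then Q (i - b) else P i
  refine ⟨_, ⟨R, fun i => ?_, rfl⟩, ?_⟩
  · dsimp only [R]
    split_ifs
    exacts [hQ _, hP _]
  have hlow : bitTensor b R = bitTensor b P :=
    bitTensor_congr fun i hi => if_neg (by omega)
  have hmid : bitTensor c (fun i => R (b + i)) = bitTensor c Q :=
    bitTensor_congr fun i hi => by simp [R, hi]
  have hhigh : bitTensor a (fun i => R (b + c + i)) = bitTensor a fun i => P (b + c + i) :=
    bitTensor_congr fun i _ => if_neg (by omega)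
  rw [embed_eq_reindex, bitTensor_eq_reindex a c b n h P, bitTensor_eq_reindex a c b n h R,
    hlow, hmid, hhigh]
  simp only [Matrix.reindex_apply, Matrix.submatrix_mul_equiv, ← Matrix.mul_kronecker_mul,
    one_mul, mul_one, hGQ]

lemma normalizesPaulis_of_one_qubit {G : Matrix (Fin (2 ^ 1)) (Fin (2 ^ 1)) ℂ}
    (h : ∀ a b, ∃ (l : ℂ) (a' b' : Bool), l ^ 4 = 1 ∧
      G * bitTensor 1 (fun _ => pauliXZ a b) =
        l • bitTensor 1 (fun _ => pauliXZ a' b') * G) : NormalizesPaulis G := by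
  have smul_eq (l : ℂ) (A : Matrix Bool Bool ℂ) :
      bitTensor 1 (fun _ => l • A) = l • bitTensor 1 fun _ => A := by
    ext u v
    simp [bitTensor]
  rintro _ ⟨P, hP, rfl⟩
  obtain ⟨l, a, b, hl, hPl⟩ := hP 0
  obtain ⟨l', a', b', hl', hG⟩ := h a b
  refine ⟨_, ⟨fun _ => (l * l') • pauliXZ a' b', fun _ => ⟨l * l', a', b', ?_, rfl⟩, rfl⟩, ?_⟩
  · rw [mul_pow, hl, hl', one_mul]
  rw [bitTensor_congr (Q := fun _ => l • pauliXZ a b) (fun i hi => by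
    rw [Nat.lt_one_iff.1 hi, hPl]), smul_eq, smul_eq, Matrix.mul_smul, hG, Matrix.smul_mul,
    Matrix.smul_mul, smul_smul]

lemma normalizesPaulis_gH : NormalizesPaulis (n := 1) gH := by
  refine normalizesPaulis_of_one_qubit fun a b =>
    ⟨if a && b then -1 else 1, b, a, by split_ifs <;> norm_num, ?_⟩
  simp only [gH, Matrix.mul_smul, Matrix.smul_mul]
  congr 1
  ext u v
  cases a <;> cases b <;> fin_cases u <;> fin_cases v <;>
    simp [Matrix.mul_apply, Fin.sum_univ_two, bitTensor, pauliXZ]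

lemma normalizesPaulis_gS : NormalizesPaulis (n := 1) gS := by
  refine normalizesPaulis_of_one_qubit fun a b =>
    ⟨if a then Complex.I else 1, a, xor a b, by split_ifs <;> simp, ?_⟩
  ext u v
  cases a <;> cases b <;> fin_cases u <;> fin_cases v <;>
    simp [Matrix.mul_apply, Fin.sum_univ_two, bitTensor, pauliXZ, gS]

lemma gCZ_eq_diagonal : gCZ = Matrix.diagonal ![1, 1, 1, -1] := by
  ext u v
  fin_cases u <;> fin_cases v <;> simp [gCZ]

lemma normalizesPaulis_gCZ : NormalizesPaulis (n := 2) gCZ := by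
  rintro _ ⟨P, hP, rfl⟩
  obtain ⟨l, a, b, hl, hP0⟩ := hP 0
  obtain ⟨l', a', b', hl', hP1⟩ := hP 1
  refine ⟨_, ⟨fun i => if i = 0 then ((if a && a' then -1 else 1) * l) • pauliXZ a (xor b a')
    else l' • pauliXZ a' (xor b' a), fun i => ?_, rfl⟩, ?_⟩
  · have hsign : ((if a && a' then -1 else 1) * l) ^ 4 = 1 := by
      rw [mul_pow, hl]
      split_ifs <;> norm_num
    by_cases hi : i = 0
    · exact ⟨_, _, _, hsign, if_pos hi⟩
    · exact ⟨_, _, _, hl', if_neg hi⟩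
  have hdiag (A : Matrix (Fin 4) (Fin 4) ℂ) (u v : Fin 4) :
      (gCZ * A) u v = ![1, 1, 1, -1] u * A u v ∧
        (A * gCZ) u v = A u v * ![1, 1, 1, -1] v := by
    simp [gCZ_eq_diagonal, Matrix.diagonal_mul, Matrix.mul_diagonal]
  ext u v
  refine (hdiag _ u v).1.trans (Eq.trans ?_ (hdiag _ u v).2.symm)
  simp only [bitTensor, Matrix.of_apply, Finset.prod_range_succ, Finset.prod_range_zero, hP0, hP1]
  cases a <;> cases b <;> cases a' <;> cases b' <;> fin_cases u <;> fin_cases v <;>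
    simp [pauliXZ, Nat.testBit]

lemma ω_pow_eight : ω ^ 8 = 1 := by
  rw [ω, ← Complex.exp_nat_mul, ← Complex.exp_two_pi_mul_I]
  congr 1
  push_cast
  ring

lemma normalizesPaulis_of_mem_cliffordGenSet {n : ℕ}
    {M : Matrix (Fin (2 ^ n)) (Fin (2 ^ n)) ℂ} (hM : M ∈ CliffordGenSet n) :
    NormalizesPaulis M := by
  rcases hM with (rfl | ⟨a, b, h, rfl | rfl⟩) | ⟨a, b, h, rfl⟩
  · exact fun A hA => ⟨A, hA, by simp⟩
  · exact normalizesPaulis_gH.embed h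
  · exact normalizesPaulis_gS.embed h
  · exact normalizesPaulis_gCZ.embed h

lemma det_embed_pow_eight {a c b n : ℕ} (h : a + c + b = n)
    {G : Matrix (Fin (2 ^ c)) (Fin (2 ^ c)) ℂ} (hG : G.det ^ 8 = 1) :
    (embed a c b n h G).det ^ 8 = 1 := by
  rw [embed_eq_reindex, Matrix.det_reindex_self, Matrix.det_kronecker, Matrix.det_kronecker]
  simp only [Matrix.det_one, one_pow, one_mul, mul_one]
  rw [pow_right_comm, pow_right_comm G.det, hG, one_pow, one_pow]

lemma det_pow_eight_of_mem_cliffordGenSet {n : ℕ}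
    {M : Matrix (Fin (2 ^ n)) (Fin (2 ^ n)) ℂ} (hM : M ∈ CliffordGenSet n) :
    M.det ^ 8 = 1 := by
  rcases hM with (rfl | ⟨a, b, h, rfl | rfl⟩) | ⟨a, b, h, rfl⟩
  · rw [Matrix.det_smul, Matrix.det_one, mul_one, ← pow_mul, mul_comm, pow_mul, ω_pow_eight,
      one_pow]
  · refine det_embed_pow_eight h ?_
    have hdet : gH.det = -1 := by
      have h2 : (Real.sqrt 2 : ℂ) ^ 2 = 2 := by
        rw [← Complex.ofReal_pow, Real.sq_sqrt zero_le_two, Complex.ofReal_ofNat]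
      rw [gH, Matrix.det_smul, Matrix.det_fin_two_of, Fintype.card_fin, inv_pow, h2]
      norm_num
    exact (congrArg (· ^ 8) hdet).trans (by norm_num)
  · refine det_embed_pow_eight h ?_
    have hdet : gS.det = Complex.I := by simp [gS, Matrix.det_fin_two_of]
    refine (congrArg (· ^ 8) hdet).trans ?_
    rw [show 8 = 4 * 2 from rfl, pow_mul, Complex.I_pow_four, one_pow]
  · refine det_embed_pow_eight h ?_
    have hdet : gCZ.det = -1 := by
      simp [gCZ_eq_diagonal, Matrix.det_diagonal, Fin.prod_univ_succ]
    exact (congrArg (· ^ 8) hdet).trans (by norm_num)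

lemma exists_testBit_ne {n : ℕ} {u v : Fin (2 ^ n)} (h : u ≠ v) :
    ∃ j < n, u.val.testBit j ≠ v.val.testBit j := by
  by_contra! H
  refine h (Fin.ext (Nat.eq_of_testBit_eq fun i => ?_))
  rcases lt_or_ge i n with hi | hi
  · exact H i hi
  · rw [Nat.testBit_lt_two_pow (u.2.trans_le (Nat.pow_le_pow_right two_pos hi)),
      Nat.testBit_lt_two_pow (v.2.trans_le (Nat.pow_le_pow_right two_pos hi))]

/-- Pauli `Z` on the bit of weight `2 ^ j`. -/
lemma bitTensor_pauliZ {n j : ℕ} (hj : j < n) :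
    bitTensor n (fun i => pauliXZ false (decide (i = j))) =
      Matrix.diagonal fun u => if u.val.testBit j then -1 else 1 := by
  ext u v
  rcases eq_or_ne u v with rfl | huv
  · rw [Matrix.diagonal_apply_eq, bitTensor, Matrix.of_apply,
      Finset.prod_eq_single_of_mem j (Finset.mem_range.2 hj)]
    · simp [pauliXZ]
    · intro i _ hij
      simp [pauliXZ, hij]
  · obtain ⟨i, hi, hne⟩ := exists_testBit_ne huv
    rw [Matrix.diagonal_apply_ne _ huv]
    exact Finset.prod_eq_zero (Finset.mem_range.2 hi) (by simp [pauliXZ, hne])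

lemma exists_eq_smul_one_of_commute {n : ℕ} {M : Matrix (Fin (2 ^ n)) (Fin (2 ^ n)) ℂ}
    (hM : ∀ P ∈ bitPaulis n, M * P = P * M) : ∃ c : ℂ, M = c • 1 := by
  have hoff (u v : Fin (2 ^ n)) (huv : u ≠ v) : M u v = 0 := by
    obtain ⟨j, hj, hne⟩ := exists_testBit_ne huv
    have := congrFun₂ (hM _ ⟨fun i => pauliXZ false (decide (i = j)),
      fun i => pauliXZ_mem_phasedPaulis _ _, rfl⟩) u v
    rw [bitTensor_pauliZ hj, Matrix.mul_diagonal, Matrix.diagonal_mul] at this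
    rcases hu : u.val.testBit j <;> rcases hv : v.val.testBit j
    · exact absurd (hu.trans hv.symm) hne
    · simpa [hu, hv, neg_eq_self] using this
    · simpa [hu, hv, self_eq_neg] using this
    · exact absurd (hu.trans hv.symm) hne
  have hdiag : M = Matrix.diagonal fun u => M u u := by
    ext u v
    rcases eq_or_ne u v with rfl | huv
    · simp
    · rw [hoff u v huv, Matrix.diagonal_apply_ne _ huv]
  refine ⟨M 0 0, ?_⟩
  have hconst (u v : Fin (2 ^ n)) : M u u = M v v := by
    let P : ℕ → Matrix Bool Bool ℂ := fun i =>
      pauliXZ (xor (v.val.testBit i) (u.val.testBit i)) false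
    have hP : bitTensor n P u v = 1 := by simp [bitTensor, P, pauliXZ]
    have := congrFun₂ (hM _ ⟨P, fun i => pauliXZ_mem_phasedPaulis _ _, rfl⟩) u v
    rw [hdiag, Matrix.diagonal_mul, Matrix.mul_diagonal, hP] at this
    simpa using this
  rw [Matrix.smul_one_eq_diagonal]
  exact hdiag.trans (congrArg _ (funext fun u => hconst u 0))

open scoped Pointwise

/-- The invertible matrices which preserve the Pauli operators under conjugation and whose
determinant is an eighth root of unity. -/
def pauliNormalizer (n : ℕ) : Subgroup (GL (Fin (2 ^ n)) ℂ) :=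
  (MulAction.stabilizer (ConjAct (GL (Fin (2 ^ n)) ℂ)) (bitPaulis n)).comap
      ConjAct.toConjAct.toMonoidHom ⊓
    (rootsOfUnity 8 ℂ).comap Matrix.GeneralLinearGroup.det

lemma mem_pauliNormalizer {n : ℕ} {g : GL (Fin (2 ^ n)) ℂ} :
    g ∈ pauliNormalizer n ↔
      (∀ P ∈ bitPaulis n, g.val * P * g⁻¹.val ∈ bitPaulis n) ∧ g.val.det ^ 8 = 1 := by
  have h := MulAction.mem_stabilizer_set_iff_smul_set_subset (a := ConjAct.toConjAct g)
    (finite_bitPaulis n)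
  rw [Set.smul_set_subset_iff] at h
  exact and_congr h Units.ext_iff

lemma finite_pauliNormalizer (n : ℕ) : (pauliNormalizer n : Set (GL (Fin (2 ^ n)) ℂ)).Finite := by
  let f (g : GL (Fin (2 ^ n)) ℂ) (P : bitPaulis n) : Matrix (Fin (2 ^ n)) (Fin (2 ^ n)) ℂ :=
    g.val * P.val * g⁻¹.val
  have := (finite_bitPaulis n).to_subtype
  refine Set.Finite.of_finite_fibers f
    ((Set.Finite.pi' fun _ : bitPaulis n => finite_bitPaulis n).subset ?_) ?_
  · rintro _ ⟨g, hg, rfl⟩ P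
    exact (mem_pauliNormalizer.1 hg).1 _ P.2
  rintro _ ⟨g, hg, rfl⟩
  refine Set.Finite.of_finite_image (f := Units.val) ?_ Units.val_injective.injOn
  refine ((finite_setOf_pow_eq_one (k := 2 ^ n * 8) (by positivity)).image
    fun c : ℂ => c • g.val).subset ?_
  rintro _ ⟨k, ⟨hk, hkg⟩, rfl⟩
  have hcomm : ∀ P ∈ bitPaulis n, (g⁻¹ * k).val * P = P * (g⁻¹ * k).val := by
    intro P hP
    have h : k.val * P * k⁻¹.val = g.val * P * g⁻¹.val := congrFun hkg ⟨P, hP⟩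
    have h' : k.val * P = g.val * P * g⁻¹.val * k.val := by
      rw [← h, mul_assoc _ _ k.val, Units.inv_mul, mul_one]
    rw [Units.val_mul, mul_assoc, h', mul_assoc, mul_assoc, Units.inv_mul_cancel_left]
  obtain ⟨c, hc⟩ := exists_eq_smul_one_of_commute hcomm
  have hkc : c • g.val = k.val := by
    rw [← Units.mul_inv_cancel_left g k.val, ← Units.val_mul, hc, Matrix.mul_smul, mul_one]
  refine ⟨c, ?_, hkc⟩
  have hdet := (mem_pauliNormalizer.1 hk).2
  rwa [← hkc, Matrix.det_smul, mul_pow, (mem_pauliNormalizer.1 hg).2, mul_one, Fintype.card_fin,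
    ← pow_mul] at hdet

/-- For every n ≥ 0, the Clifford group on n qubits is finite. -/
theorem cliffordGroup_finite (n : ℕ) : Finite (CliffordGroup n) := by
  have hle : CliffordGroup n ≤ pauliNormalizer n := by
    refine (Subgroup.closure_le _).2 fun g hg => mem_pauliNormalizer.2 ⟨fun P hP => ?_,
      det_pow_eight_of_mem_cliffordGenSet hg⟩
    obtain ⟨P', hP', h⟩ := normalizesPaulis_of_mem_cliffordGenSet hg P hP
    rwa [h, Units.mul_inv_cancel_right]
  exact ((finite_pauliNormalizer n).subset hle).to_subtype
end
end
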